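/- arXiv:0806.2559 — 4 statements merged into one kernel-verified Lean document; each statement's English description precedes it below -/
import Mathlib

section
/- Let T be a nonempty index set and (Y(t))_{t∈T} a real-valued stochastic process with Y(t₀) = 0 almost surely for some t₀ ∈ T, such that sup_{t∈T} |Y(t)| and sup_{s,t∈T} |Y(s) − Y(t)| are random variables. Assume Y satisfies the following consequence of the Anderson property: for every c ∈ ℝ and r > 0, P(sup_{t∈T} |Y(t) − c| ≤ r) ≤ P(sup_{t∈T} |Y(t)| ≤ r). Let τ > 0, κ > 0, and let ℓ : (0,∞) → (0,∞) satisfy ℓ(λε)/ℓ(ε) → 1 as ε → 0⁺ for every λ > 0 (ℓ slowly varying at 0). Then −log P(sup_{s,t∈T} |Y(s) − Y(t)| ≤ ε) ∼ κ ε^{−τ} ℓ(ε) as ε → 0 if and only if −log P(sup_{t∈T} |Y(t)| ≤ ε) ∼ κ 2^{−τ} ε^{−τ} ℓ(ε) as ε → 0. -/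
open MeasureTheory ProbabilityTheory Filter Set
open scoped NNReal ENNReal

noncomputable section

/-- `f ∼ g` as `ε → 0⁺`: the ratio `f/g` tends to `1`. -/
def strongEquiv (f g : ℝ → ℝ) : Prop :=
  Filter.Tendsto (fun ε => f ε / g ε) (nhdsWithin 0 (Set.Ioi 0)) (nhds 1)

theorem tendsto_const_mul_nhdsGT_zero {lam : ℝ} (hlam : 0 < lam) :
    Tendsto (fun ε => lam * ε) (nhdsWithin 0 (Ioi 0)) (nhdsWithin 0 (Ioi 0)) := by
  refine tendsto_nhdsWithin_iff.2 ⟨tendsto_nhdsWithin_of_tendsto_nhds ?_, ?_⟩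
  · exact Continuous.tendsto' (by fun_prop) _ _ (mul_zero _)
  · filter_upwards [self_mem_nhdsWithin] with ε hε
    exact mul_pos hlam hε

theorem tendsto_comp_mul_div {F K : ℝ → ℝ} {τ lam : ℝ} (hlam : 0 < lam)
    (hKpos : ∀ ε, 0 < ε → 0 < K ε)
    (hK : Tendsto (fun ε => K (lam * ε) / K ε) (nhdsWithin 0 (Ioi 0)) (nhds (lam ^ (-τ))))
    (hF : strongEquiv F K) :
    Tendsto (fun ε => F (lam * ε) / K ε) (nhdsWithin 0 (Ioi 0)) (nhds (lam ^ (-τ))) := by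
  have h := (Tendsto.comp hF (tendsto_const_mul_nhdsGT_zero hlam)).mul hK
  rw [one_mul] at h
  refine h.congr' ?_
  filter_upwards [self_mem_nhdsWithin] with ε hε
  have h1 := (hKpos ε hε).ne'
  have h2 := (hKpos (lam * ε) (mul_pos hlam hε)).ne'
  simp only [Function.comp]
  field_simp

/-- An antitone function equivalent to a function of regular variation with negative exponent at
`0⁺` tends to infinity there. -/
theorem tendsto_atTop_of_strongEquiv_of_antitoneOn {F K : ℝ → ℝ} {τ : ℝ} (hτ : 0 < τ)
    (hKpos : ∀ ε, 0 < ε → 0 < K ε)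
    (hK : ∀ lam, 0 < lam →
      Tendsto (fun ε => K (lam * ε) / K ε) (nhdsWithin 0 (Ioi 0)) (nhds (lam ^ (-τ))))
    (hanti : AntitoneOn F (Ioi 0)) (hF : strongEquiv F K) :
    Tendsto F (nhdsWithin 0 (Ioi 0)) atTop := by
  have hratio : Tendsto (fun ε => F (2⁻¹ * ε) / F ε) (nhdsWithin 0 (Ioi 0))
      (nhds ((2⁻¹ : ℝ) ^ (-τ))) := by
    have h := (tendsto_comp_mul_div (by norm_num) hKpos (hK 2⁻¹ (by norm_num)) hF).div hF one_ne_zero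
    rw [div_one] at h
    refine h.congr' ?_
    filter_upwards [self_mem_nhdsWithin] with ε hε
    exact div_div_div_cancel_right₀ (hKpos ε hε).ne' _ _
  have hFpos : ∀ᶠ ε in nhdsWithin 0 (Ioi 0), 0 < F ε := by
    filter_upwards [hF.eventually (lt_mem_nhds one_pos), self_mem_nhdsWithin] with ε h hε
    exact (div_pos_iff_of_pos_right (hKpos ε hε)).1 h
  let x : ℕ → ℝ := fun n => (2⁻¹ : ℝ) ^ n
  have hxpos : ∀ n, 0 < x n := fun n => by positivity
  have hx : Tendsto x atTop (nhdsWithin 0 (Ioi 0)) :=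
    tendsto_nhdsWithin_iff.2 ⟨tendsto_pow_atTop_nhds_zero_of_lt_one (by norm_num) (by norm_num),
      Eventually.of_forall hxpos⟩
  have hxanti : Antitone x := fun m n h => pow_le_pow_of_le_one (by norm_num) (by norm_num) h
  have hmono : Monotone (F ∘ x) := fun m n h => hanti (hxpos n) (hxpos m) (hxanti h)
  have htop : Tendsto (F ∘ x) atTop atTop := by
    refine (tendsto_atTop_of_monotone hmono).resolve_right ?_
    rintro ⟨l, hl⟩
    obtain ⟨N, hN⟩ := (hx.eventually hFpos).exists
    have hlpos : 0 < l := lt_of_lt_of_le hN (hmono.ge_of_tendsto hl N)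
    have hl1 : Tendsto (fun n => F (x (n + 1))) atTop (nhds l) := hl.comp (tendsto_add_atTop_nat 1)
    have h1 : Tendsto (fun n => F (x (n + 1)) / F (x n)) atTop (nhds 1) := by
      have := hl1.div hl hlpos.ne'
      rwa [div_self hlpos.ne'] at this
    have h2 : Tendsto (fun n => F (x (n + 1)) / F (x n)) atTop (nhds ((2⁻¹ : ℝ) ^ (-τ))) := by
      refine (hratio.comp hx).congr fun n => ?_
      simp only [Function.comp, x, pow_succ']
    have h3 := tendsto_nhds_unique h1 h2
    have h4 := Real.one_lt_rpow_of_pos_of_lt_one_of_neg (x := (2⁻¹ : ℝ)) (z := -τ) (by norm_num)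
      (by norm_num) (by linarith)
    linarith
  refine tendsto_atTop.2 fun b => ?_
  obtain ⟨n, hn⟩ := (htop.eventually_ge_atTop b).exists
  filter_upwards [Ioc_mem_nhdsGT (hxpos n)] with ε hε
  exact hn.trans (hanti hε.1 (hxpos n) hε.2)

/-- Two monotone small ball functions dominating each other, up to a constant factor and an
arbitrarily small dilation, have the same logarithmic asymptotics of regular variation. -/
theorem strongEquiv_neg_log_of_dilation_le {P Q K : ℝ → ℝ} {τ : ℝ} (hτ : 0 < τ)
    (hKpos : ∀ ε, 0 < ε → 0 < K ε)
    (hK : ∀ lam, 0 < lam →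
      Tendsto (fun ε => K (lam * ε) / K ε) (nhdsWithin 0 (Ioi 0)) (nhds (lam ^ (-τ))))
    (hPmono : Monotone P) (hP0 : ∀ ε, 0 ≤ P ε)
    (hPQ : ∀ lam, 1 < lam → ∃ N : ℝ, 0 < N ∧ ∀ ε, 0 < ε → P ε ≤ N * Q (lam * ε))
    (hQP : ∀ lam, 1 < lam → ∃ N : ℝ, 0 < N ∧ ∀ ε, 0 < ε → Q ε ≤ N * P (lam * ε))
    (hF : strongEquiv (fun ε => -Real.log (P ε)) K) :
    strongEquiv (fun ε => -Real.log (Q ε)) K := by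
  have hPpos : ∀ ε, 0 < ε → 0 < P ε := by
    intro ε hε
    obtain ⟨x, hx, hxε⟩ :=
      ((hF.eventually (lt_mem_nhds one_pos)).and (Ioc_mem_nhdsGT hε)).exists
    have hne : P x ≠ 0 := by
      intro h
      simp [h] at hx
    exact ((hP0 x).lt_of_ne' hne).trans_le (hPmono hxε.2)
  have hQpos : ∀ ε, 0 < ε → 0 < Q ε := by
    intro ε hε
    obtain ⟨N, hN, h⟩ := hPQ 2 one_lt_two
    have h1 := (hPpos _ (half_pos hε)).trans_le (h _ (half_pos hε))
    rw [mul_div_cancel₀ ε two_ne_zero] at h1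
    exact pos_of_mul_pos_right h1 hN.le
  have hanti : AntitoneOn (fun ε => -Real.log (P ε)) (Ioi 0) := fun x hx y _ hxy =>
    neg_le_neg (Real.log_le_log (hPpos x hx) (hPmono hxy))
  have hFtop := tendsto_atTop_of_strongEquiv_of_antitoneOn hτ hKpos hK hanti hF
  have hKtop : Tendsto K (nhdsWithin 0 (Ioi 0)) atTop := by
    refine tendsto_atTop_mono' _ ?_ (hFtop.const_mul_atTop (r := 2⁻¹) (by norm_num))
    filter_upwards [hF.eventually (gt_mem_nhds one_lt_two), self_mem_nhdsWithin] with ε h hε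
    rw [div_lt_iff₀ (hKpos ε hε)] at h
    linarith
  have hdil (C lam : ℝ) (hlam : 0 < lam) :
      Tendsto (fun ε => (-Real.log (P (lam * ε)) + C) / K ε) (nhdsWithin 0 (Ioi 0))
        (nhds (lam ^ (-τ))) := by
    have h := (tendsto_comp_mul_div hlam hKpos (hK lam hlam) hF).add
      (tendsto_const_nhds.div_atTop hKtop : Tendsto (fun ε => C / K ε) _ _)
    simpa only [add_zero, ← add_div] using h
  have hcont : ContinuousAt (fun lam : ℝ => lam ^ (-τ)) 1 :=
    Real.continuousAt_rpow_const 1 (-τ) (Or.inl one_ne_zero)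
  have hlim : Tendsto (fun lam : ℝ => lam ^ (-τ)) (nhdsWithin 1 (Ioi 1)) (nhds 1) := by
    have := hcont.tendsto.mono_left (nhdsWithin_le_nhds (s := Ioi 1))
    simpa using this
  have hlim' : Tendsto (fun lam : ℝ => lam⁻¹ ^ (-τ)) (nhdsWithin 1 (Ioi 1)) (nhds 1) := by
    have h := hlim.inv₀ one_ne_zero
    rw [inv_one] at h
    refine h.congr' ?_
    filter_upwards [self_mem_nhdsWithin] with lam hlam
    exact (Real.inv_rpow (zero_le_one.trans (mem_Ioi.1 hlam).le) _).symm
  refine tendsto_order.2 ⟨fun a ha => ?_, fun a ha => ?_⟩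
  · obtain ⟨lam, h, hlam⟩ := ((hlim.eventually (lt_mem_nhds ha)).and self_mem_nhdsWithin).exists
    have hlam0 : 0 < lam := one_pos.trans hlam
    obtain ⟨N, hN, hb⟩ := hQP lam hlam
    filter_upwards [(hdil (-Real.log N) lam hlam0).eventually (lt_mem_nhds h),
      self_mem_nhdsWithin] with ε hε hε0
    refine hε.trans_le (div_le_div_of_nonneg_right ?_ (hKpos ε hε0).le)
    have h1 := Real.log_le_log (hQpos ε hε0) (hb ε hε0)
    rw [Real.log_mul hN.ne' (hPpos _ (mul_pos hlam0 hε0)).ne'] at h1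
    linarith
  · obtain ⟨lam, h, hlam⟩ := ((hlim'.eventually (gt_mem_nhds ha)).and self_mem_nhdsWithin).exists
    have hlam0 : 0 < lam := one_pos.trans hlam
    obtain ⟨N, hN, hb⟩ := hPQ lam hlam
    filter_upwards [(hdil (Real.log N) lam⁻¹ (inv_pos.2 hlam0)).eventually (gt_mem_nhds h),
      self_mem_nhdsWithin] with ε hε hε0
    refine (div_le_div_of_nonneg_right ?_ (hKpos ε hε0).le).trans_lt hε
    have hε1 : 0 < lam⁻¹ * ε := mul_pos (inv_pos.2 hlam0) hε0
    have h1 := Real.log_le_log (hPpos _ hε1) (hb _ hε1)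
    rw [mul_inv_cancel_left₀ hlam0.ne', Real.log_mul hN.ne' (hQpos _ hε0).ne'] at h1
    linarith

section Oscillation

variable {T : Type*}

theorem bddAbove_range_abs_sub_iff (y : T → ℝ) (c : ℝ) :
    BddAbove (range fun t => |y t - c|) ↔ BddAbove (range fun t => |y t|) := by
  constructor
  · rintro ⟨B, hB⟩
    refine ⟨B + |c|, ?_⟩
    rintro _ ⟨t, rfl⟩
    have h1 : |y t - c| ≤ B := hB ⟨t, rfl⟩
    have h2 := abs_sub_abs_le_abs_sub (y t) c
    dsimp only
    linarith
  · rintro ⟨B, hB⟩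
    refine ⟨B + |c|, ?_⟩
    rintro _ ⟨t, rfl⟩
    have h1 : |y t| ≤ B := hB ⟨t, rfl⟩
    have h2 := abs_sub (y t) c
    dsimp only
    linarith

theorem iSup_abs_sub_eq_zero_of_not_bddAbove {y : T → ℝ}
    (hy : ¬ BddAbove (range fun t => |y t|)) (c : ℝ) : ⨆ t, |y t - c| = 0 :=
  Real.iSup_of_not_bddAbove fun h => hy ((bddAbove_range_abs_sub_iff y c).1 h)

theorem iSup_iSup_abs_sub_le [Nonempty T] {y : T → ℝ} {r : ℝ} (hr : 0 ≤ r) (h : ⨆ t, |y t| ≤ r) :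
    ⨆ s, ⨆ t, |y s - y t| ≤ 2 * r := by
  refine ciSup_le fun s => ?_
  by_cases hy : BddAbove (range fun t => |y t|)
  · have hb t : |y t| ≤ r := (le_ciSup hy t).trans h
    refine ciSup_le fun t => (abs_sub _ _).trans ?_
    linarith [hb s, hb t]
  · simp only [abs_sub_comm (y s), iSup_abs_sub_eq_zero_of_not_bddAbove hy]
    linarith

theorem abs_sub_le_of_iSup_iSup_le [Nonempty T] {y : T → ℝ} {r : ℝ} (hy : BddAbove (range fun t => |y t|))
    (h : ⨆ s, ⨆ t, |y s - y t| ≤ r) (s t : T) : |y s - y t| ≤ r := by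
  obtain ⟨B, hB⟩ := hy
  have hB' s t : |y s - y t| ≤ B + B :=
    (abs_sub _ _).trans (add_le_add (hB ⟨s, rfl⟩) (hB ⟨t, rfl⟩))
  refine le_trans ?_ h
  refine le_trans ?_ (le_ciSup (f := fun s => ⨆ t, |y s - y t|) ⟨B + B, ?_⟩ s)
  · exact le_ciSup (f := fun t => |y s - y t|) ⟨B + B, by rintro _ ⟨t, rfl⟩; exact hB' s t⟩ t
  · rintro _ ⟨s, rfl⟩
    exact ciSup_le fun t => hB' s t

/-- A function of oscillation at most `2 r` that vanishes somewhere lies in a ball of radius `r`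
whose centre has absolute value at most `r`. -/
theorem exists_abs_sub_le_of_abs_sub_le [Nonempty T] {y : T → ℝ} {r : ℝ} {t₀ : T} (h0 : y t₀ = 0)
    (h : ∀ s t, |y s - y t| ≤ 2 * r) : ∃ m, |m| ≤ r ∧ ∀ t, |y t - m| ≤ r := by
  have hle s t : y s ≤ y t + 2 * r := by linarith [(abs_le.1 (h s t)).2]
  have ha : BddBelow (range y) :=
    ⟨y t₀ - 2 * r, by rintro _ ⟨t, rfl⟩; linarith [hle t₀ t]⟩
  have h1 t : ⨅ s, y s ≤ y t := ciInf_le ha t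
  have h2 t : y t ≤ (⨅ s, y s) + 2 * r := by
    have : y t - 2 * r ≤ ⨅ s, y s := le_ciInf fun s => by linarith [hle t s]
    linarith
  refine ⟨(⨅ s, y s) + r, abs_le.2 ⟨?_, ?_⟩, fun t => abs_le.2 ⟨?_, ?_⟩⟩
  all_goals linarith [h1 t₀, h2 t₀, h1 ‹T›, h2 ‹T›]

theorem exists_int_iSup_abs_sub_le [Nonempty T] {y : T → ℝ} {r δ : ℝ} (hr : 0 < r) (hδ : 0 < δ) {t₀ : T}
    (h0 : y t₀ = 0) (h : ⨆ s, ⨆ t, |y s - y t| ≤ 2 * r) :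
    ∃ j ∈ Finset.Icc (-(⌈δ⁻¹⌉ + 1)) (⌈δ⁻¹⌉ + 1), ⨆ t, |y t - j * (δ * r)| ≤ (1 + δ) * r := by
  have hδr : 0 < δ * r := mul_pos hδ hr
  by_cases hy : BddAbove (range fun t => |y t|)
  · obtain ⟨m, hm, hym⟩ :=
      exists_abs_sub_le_of_abs_sub_le h0 (abs_sub_le_of_iSup_iSup_le hy h)
    have hfl := Int.floor_le (m / (δ * r))
    have hlf := Int.lt_floor_add_one (m / (δ * r))
    have hmδ : |m / (δ * r)| ≤ δ⁻¹ := by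
      rw [abs_div, abs_of_pos hδr, div_le_iff₀ hδr, inv_mul_cancel_left₀ hδ.ne']
      exact hm
    have hce := Int.le_ceil δ⁻¹
    rw [abs_le] at hmδ
    refine ⟨⌊m / (δ * r)⌋, Finset.mem_Icc.2 ⟨?_, ?_⟩, ciSup_le fun t => ?_⟩
    · have : (-(⌈δ⁻¹⌉ + 1 : ℤ) : ℝ) ≤ ⌊m / (δ * r)⌋ := by push_cast; linarith
      exact_mod_cast this
    · have : (⌊m / (δ * r)⌋ : ℝ) ≤ (⌈δ⁻¹⌉ + 1 : ℤ) := by push_cast; linarith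
      exact_mod_cast this
    · rw [le_div_iff₀ hδr] at hfl
      rw [div_lt_iff₀ hδr] at hlf
      have := abs_le.1 (hym t)
      exact abs_le.2 ⟨by linarith, by linarith⟩
  · refine ⟨0, Finset.mem_Icc.2 ?_, ?_⟩
    · have : 0 < ⌈δ⁻¹⌉ := Int.ceil_pos.2 (inv_pos.2 hδ)
      constructor <;> linarith
    · rw [iSup_abs_sub_eq_zero_of_not_bddAbove hy]
      positivity

end Oscillation

theorem strongEquiv_comp_two_mul_iff {g ℓ : ℝ → ℝ} {τ κ : ℝ} (hκ : 0 < κ)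
    (hℓpos : ∀ ε : ℝ, 0 < ε → 0 < ℓ ε)
    (hℓ : Tendsto (fun ε => ℓ (2 * ε) / ℓ ε) (nhdsWithin 0 (Ioi 0)) (nhds 1)) :
    strongEquiv g (fun ε => κ * ε ^ (-τ) * ℓ ε) ↔
      strongEquiv (fun ε => g (2 * ε)) (fun ε => κ * 2 ^ (-τ) * ε ^ (-τ) * ℓ ε) := by
  have hkey : ∀ ε : ℝ, 0 < ε → g (2 * ε) / (κ * (2 * ε) ^ (-τ) * ℓ (2 * ε)) * (ℓ (2 * ε) / ℓ ε) =
      g (2 * ε) / (κ * 2 ^ (-τ) * ε ^ (-τ) * ℓ ε) := by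
    intro ε hε
    have h1 := (hℓpos ε hε).ne'
    have h2 := (hℓpos (2 * ε) (by positivity)).ne'
    rw [Real.mul_rpow zero_le_two hε.le]
    have h3 := (Real.rpow_pos_of_pos hε (-τ)).ne'
    have h4 := (Real.rpow_pos_of_pos two_pos (-τ)).ne'
    field_simp
  constructor
  · intro h
    have h' := (Tendsto.comp h (tendsto_const_mul_nhdsGT_zero two_pos)).mul hℓ
    rw [one_mul] at h'
    refine h'.congr' ?_
    filter_upwards [self_mem_nhdsWithin] with ε hε
    exact hkey ε hε
  · intro h
    have h' := Tendsto.div h hℓ one_ne_zero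
    rw [div_one] at h'
    have h'' := h'.comp (tendsto_const_mul_nhdsGT_zero (inv_pos.2 (two_pos (α := ℝ))))
    refine h''.congr' ?_
    filter_upwards [self_mem_nhdsWithin] with ε hε
    have hε' : 0 < 2⁻¹ * ε := mul_pos (by norm_num) hε
    have h1 := div_pos (hℓpos (2 * (2⁻¹ * ε)) (by positivity)) (hℓpos _ hε')
    simp only [Function.comp, Pi.div_apply]
    rw [← hkey _ hε', mul_div_cancel_right₀ _ h1.ne', mul_inv_cancel_left₀ two_ne_zero]

theorem statement3 {Ω : Type*} [MeasureSpace Ω] [IsProbabilityMeasure (ℙ : Measure Ω)]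
    {T : Type*} [Nonempty T]
    (Y : T → Ω → ℝ) (t₀ : T) (hY0 : ∀ᵐ ω ∂ℙ, Y t₀ ω = 0)
    (hMeasSup : Measurable fun ω => ⨆ t, |Y t ω|)
    (hMeasRange : Measurable fun ω => ⨆ s, ⨆ t, |Y s ω - Y t ω|)
    -- consequence of the Anderson property:
    (hAnderson : ∀ (c : ℝ) (r : ℝ), 0 < r →
      ℙ {ω | ⨆ t, |Y t ω - c| ≤ r} ≤ ℙ {ω | ⨆ t, |Y t ω| ≤ r})
    (τ κ : ℝ) (hτ : 0 < τ) (hκ : 0 < κ)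
    (ℓ : ℝ → ℝ) (hℓpos : ∀ ε : ℝ, 0 < ε → 0 < ℓ ε)
    (hℓslow : ∀ lam : ℝ, 0 < lam →
      Filter.Tendsto (fun ε => ℓ (lam * ε) / ℓ ε) (nhdsWithin 0 (Set.Ioi 0)) (nhds 1)) :
    strongEquiv
      (fun ε => -Real.log ((ℙ {ω | ⨆ s, ⨆ t, |Y s ω - Y t ω| ≤ ε}).toReal))
      (fun ε => κ * ε ^ (-τ) * ℓ ε)
    ↔
    strongEquiv
      (fun ε => -Real.log ((ℙ {ω | ⨆ t, |Y t ω| ≤ ε}).toReal))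
      (fun ε => κ * 2 ^ (-τ) * ε ^ (-τ) * ℓ ε) := by
  set p : ℝ → ℝ := fun ε => (ℙ {ω | ⨆ t, |Y t ω| ≤ ε}).toReal
  set q : ℝ → ℝ := fun ε => (ℙ {ω | ⨆ s, ⨆ t, |Y s ω - Y t ω| ≤ ε}).toReal
  have hpmono : Monotone p := fun x y hxy =>
    ENNReal.toReal_mono (measure_ne_top _ _) (measure_mono fun ω hω => le_trans hω hxy)
  have hqmono : Monotone q := fun x y hxy =>
    ENNReal.toReal_mono (measure_ne_top _ _) (measure_mono fun ω hω => le_trans hω hxy)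
  have hq2mono : Monotone fun ε => q (2 * ε) := fun x y hxy => hqmono (by linarith)
  have hpq : ∀ lam : ℝ, 1 < lam →
      ∃ N : ℝ, 0 < N ∧ ∀ ε, 0 < ε → p ε ≤ N * q (2 * (lam * ε)) := by
    refine fun lam hlam => ⟨1, one_pos, fun ε hε => ?_⟩
    rw [one_mul]
    refine le_trans ?_ (hq2mono (show ε ≤ lam * ε by nlinarith))
    exact ENNReal.toReal_mono (measure_ne_top _ _)
      (measure_mono fun ω hω => iSup_iSup_abs_sub_le hε.le hω)
  have hqp : ∀ lam : ℝ, 1 < lam →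
      ∃ N : ℝ, 0 < N ∧ ∀ ε, 0 < ε → q (2 * ε) ≤ N * p (lam * ε) := by
    intro lam hlam
    obtain ⟨δ, hδ, rfl⟩ : ∃ δ : ℝ, 0 < δ ∧ lam = 1 + δ := ⟨lam - 1, by linarith, by ring⟩
    set J : Finset ℤ := Finset.Icc (-(⌈δ⁻¹⌉ + 1)) (⌈δ⁻¹⌉ + 1)
    have hJne : J.Nonempty := by
      have : 0 < ⌈δ⁻¹⌉ := Int.ceil_pos.2 (inv_pos.2 hδ)
      exact Finset.nonempty_Icc.2 (by linarith)
    refine ⟨J.card, by exact_mod_cast hJne.card_pos, fun ε hε => ?_⟩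
    have hle : ℙ {ω | ⨆ s, ⨆ t, |Y s ω - Y t ω| ≤ 2 * ε} ≤
        J.card * ℙ {ω | ⨆ t, |Y t ω| ≤ (1 + δ) * ε} := calc
      _ ≤ ℙ (⋃ j ∈ J, {ω | ⨆ t, |Y t ω - j * (δ * ε)| ≤ (1 + δ) * ε}) := by
        refine measure_mono_ae ?_
        filter_upwards [hY0] with ω h0 hω
        obtain ⟨j, hj, h⟩ := exists_int_iSup_abs_sub_le (y := fun t => Y t ω) hε hδ h0 hω
        exact mem_biUnion hj h
      _ ≤ ∑ j ∈ J, ℙ {ω | ⨆ t, |Y t ω - j * (δ * ε)| ≤ (1 + δ) * ε} :=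
        measure_biUnion_finset_le _ _
      _ ≤ ∑ _j ∈ J, ℙ {ω | ⨆ t, |Y t ω| ≤ (1 + δ) * ε} :=
        Finset.sum_le_sum fun j _ => hAnderson _ _ (by positivity)
      _ = _ := by rw [Finset.sum_const, nsmul_eq_mul]
    have h := ENNReal.toReal_mono
      (ENNReal.mul_ne_top (ENNReal.natCast_ne_top _) (measure_ne_top _ _)) hle
    rwa [ENNReal.toReal_mul, ENNReal.toReal_natCast] at h
  have hKpos : ∀ ε : ℝ, 0 < ε → 0 < κ * 2 ^ (-τ) * ε ^ (-τ) * ℓ ε := fun ε hε => by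
    have := hℓpos ε hε
    positivity
  have hK : ∀ lam : ℝ, 0 < lam →
      Tendsto (fun ε => κ * 2 ^ (-τ) * (lam * ε) ^ (-τ) * ℓ (lam * ε) /
        (κ * 2 ^ (-τ) * ε ^ (-τ) * ℓ ε)) (nhdsWithin 0 (Ioi 0)) (nhds (lam ^ (-τ))) := by
    intro lam hlam
    have h := (hℓslow lam hlam).const_mul (lam ^ (-τ))
    rw [mul_one] at h
    refine h.congr' ?_
    filter_upwards [self_mem_nhdsWithin] with ε hε
    have h1 := (hℓpos ε hε).ne'
    have h3 := (Real.rpow_pos_of_pos hε (-τ)).ne'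
    have h4 := (Real.rpow_pos_of_pos two_pos (-τ)).ne'
    rw [Real.mul_rpow hlam.le (mem_Ioi.1 hε).le]
    field_simp
  rw [strongEquiv_comp_two_mul_iff hκ hℓpos (hℓslow 2 two_pos)]
  exact ⟨strongEquiv_neg_log_of_dilation_le hτ hKpos hK hq2mono
      (fun _ => ENNReal.toReal_nonneg) hqp hpq,
    strongEquiv_neg_log_of_dilation_le hτ hKpos hK hpmono
      (fun _ => ENNReal.toReal_nonneg) hpq hqp⟩
end
end

section
/- Let (Y(t))_{t∈[0,1]} be a real-valued stochastic process with Y(0) = 0 almost surely, such that sup_{t∈[0,1]} |Y(t)| and sup_{s,t∈[0,1]} |Y(t) − Y(s)| are random variables. Let p > 0 and τ > 0. If −log P(sup_{t∈[0,1]} |Y(t)| ≤ ε) ≈ ε^{−τ} as ε → 0, then −log E[exp(−λ · sup_{s,t∈[0,1]} |Y(t) − Y(s)|^p)] ≈ λ^{1/(1 + p/τ)} as λ → ∞. -/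
open MeasureTheory ProbabilityTheory Filter Set
open scoped NNReal ENNReal

noncomputable section

/-- `f ≈ g` along the filter `l`: the ratio `f/g` has positive liminf and finite limsup. -/
def weakEquivAlong (l : Filter ℝ) (f g : ℝ → ℝ) : Prop :=
  0 < Filter.liminf (fun x => ((f x / g x : ℝ) : EReal)) l ∧
  Filter.limsup (fun x => ((f x / g x : ℝ) : EReal)) l < ⊤

theorem weakEquivAlong.exists_bounds {l : Filter ℝ} {f g : ℝ → ℝ} (h : weakEquivAlong l f g) :
    ∃ c C : ℝ, 0 < c ∧ (∀ᶠ x in l, c < f x / g x) ∧ ∀ᶠ x in l, f x / g x < C := by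
  obtain ⟨h₁, h₂⟩ := h
  obtain ⟨c, hc0, hc⟩ := EReal.lt_iff_exists_real_btwn.1 h₁
  obtain ⟨C, hC, -⟩ := EReal.lt_iff_exists_real_btwn.1 h₂
  exact ⟨c, C, by exact_mod_cast hc0,
    (eventually_lt_of_lt_liminf hc).mono fun x hx => by exact_mod_cast hx,
    (eventually_lt_of_limsup_lt hC).mono fun x hx => by exact_mod_cast hx⟩

theorem weakEquivAlong_of_bounds {l : Filter ℝ} {f g : ℝ → ℝ} {c C : ℝ} (hc : 0 < c)
    (h₁ : ∀ᶠ x in l, c ≤ f x / g x) (h₂ : ∀ᶠ x in l, f x / g x ≤ C) :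
    weakEquivAlong l f g := by
  constructor
  · refine lt_of_lt_of_le (b := (c : EReal)) (by exact_mod_cast hc) (le_liminf_of_le ?_ ?_)
    · isBoundedDefault
    · exact h₁.mono fun x hx => by exact_mod_cast hx
  · refine lt_of_le_of_lt (b := (C : EReal)) (limsup_le_of_le ?_ ?_) (EReal.coe_lt_top C)
    · isBoundedDefault
    · exact h₂.mono fun x hx => by exact_mod_cast hx

theorem Real.biSup_nonneg {ι : Type*} {s : Set ι} {f : ι → ℝ} (hf : ∀ i, 0 ≤ f i) :
    0 ≤ ⨆ i ∈ s, f i :=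
  Real.iSup_nonneg fun i => Real.iSup_nonneg fun _ => hf i

theorem Real.biSup_le {ι : Type*} {s : Set ι} {f : ι → ℝ} {a : ℝ} (ha : 0 ≤ a)
    (hf : ∀ i ∈ s, f i ≤ a) : ⨆ i ∈ s, f i ≤ a :=
  Real.iSup_le (fun i => Real.iSup_le (hf i) ha) ha

theorem Real.le_biSup {ι : Type*} {s : Set ι} {f : ι → ℝ} {a : ℝ} (ha : 0 ≤ a)
    (hf : ∀ i ∈ s, f i ≤ a) {i : ι} (hi : i ∈ s) : f i ≤ ⨆ i ∈ s, f i := by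
  have hb : BddAbove (range fun i => ⨆ _ : i ∈ s, f i) :=
    ⟨a, by rintro _ ⟨j, rfl⟩; exact Real.iSup_le (hf j) ha⟩
  simpa [hi] using le_ciSup hb i

theorem Real.biSup_eq_zero_of_unbounded {ι : Type*} {s : Set ι} {f : ι → ℝ}
    (h : ¬ ∃ a, ∀ i ∈ s, f i ≤ a) : ⨆ i ∈ s, f i = 0 := by
  refine Real.iSup_of_not_bddAbove fun ⟨a, ha⟩ => h ⟨a, fun i hi => ?_⟩
  simpa [hi] using ha ⟨i, rfl⟩

/-- The oscillation of a function vanishing at a point of `s` is comparable to the supremum of its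
absolute value. Boundedness is not needed: for an unbounded function both suprema are `0`. -/
theorem biSup_abs_le_oscillation_le {ι : Type*} {s : Set ι} {y : ι → ℝ} {i₀ : ι} (hi₀ : i₀ ∈ s)
    (h0 : y i₀ = 0) :
    (⨆ t ∈ s, |y t|) ≤ (⨆ u ∈ s, ⨆ t ∈ s, |y t - y u|) ∧
      (⨆ u ∈ s, ⨆ t ∈ s, |y t - y u|) ≤ 2 * ⨆ t ∈ s, |y t| := by
  have hM : 0 ≤ ⨆ t ∈ s, |y t| := Real.biSup_nonneg fun t => abs_nonneg _
  by_cases hb : ∃ a, ∀ t ∈ s, |y t| ≤ a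
  · obtain ⟨a, ha⟩ := hb
    have ha0 : 0 ≤ a := (abs_nonneg _).trans (ha i₀ hi₀)
    have hle : ∀ t ∈ s, |y t| ≤ ⨆ t ∈ s, |y t| := fun t ht => Real.le_biSup ha0 ha ht
    have hdiff : ∀ u ∈ s, ∀ t ∈ s, |y t - y u| ≤ 2 * ⨆ t ∈ s, |y t| := fun u hu t ht => by
      linarith [abs_sub (y t) (y u), hle t ht, hle u hu]
    have hinner : ∀ u ∈ s, (⨆ t ∈ s, |y t - y u|) ≤ 2 * ⨆ t ∈ s, |y t| := fun u hu =>
      Real.biSup_le (by positivity) (hdiff u hu)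
    refine ⟨?_, Real.biSup_le (by positivity) hinner⟩
    simpa [h0] using Real.le_biSup (f := fun u => ⨆ t ∈ s, |y t - y u|) (by positivity) hinner hi₀
  · have hinner : ∀ u, (⨆ t ∈ s, |y t - y u|) = 0 := fun u =>
      Real.biSup_eq_zero_of_unbounded fun ⟨a, ha⟩ => hb ⟨a + |y u|, fun t ht => by
        linarith [ha t ht, abs_sub_abs_le_abs_sub (y t) (y u)]⟩
    rw [Real.biSup_eq_zero_of_unbounded hb]
    simp [hinner]

section LaplaceTransform

variable {Ω : Type*} [MeasurableSpace Ω] {μ : Measure Ω} [IsProbabilityMeasure μ] {R : Ω → ℝ}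

theorem integrable_exp_neg_mul_rpow (hR : Measurable R) (hR0 : ∀ ω, 0 ≤ R ω) (p : ℝ) {lam : ℝ}
    (hlam : 0 ≤ lam) : Integrable (fun ω => Real.exp (-(lam * R ω ^ p))) μ := by
  refine Integrable.of_bound (C := 1)
    ((hR.pow_const p).const_mul lam).neg.exp.aestronglyMeasurable (ae_of_all _ fun ω => ?_)
  rw [Real.norm_eq_abs, Real.abs_exp, Real.exp_le_one_iff]
  have := Real.rpow_nonneg (hR0 ω) p
  linarith [mul_nonneg hlam this]

theorem integral_exp_neg_mul_rpow_le (hR : Measurable R) (hR0 : ∀ ω, 0 ≤ R ω) {p lam ε : ℝ}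
    (hp : 0 ≤ p) (hlam : 0 ≤ lam) (hε : 0 ≤ ε) :
    ∫ ω, Real.exp (-(lam * R ω ^ p)) ∂μ ≤ μ.real {ω | R ω ≤ ε} + Real.exp (-(lam * ε ^ p)) := by
  have hs : MeasurableSet {ω | R ω ≤ ε} := measurableSet_le hR measurable_const
  have hi : Integrable ({ω | R ω ≤ ε}.indicator fun _ => (1 : ℝ)) μ :=
    (integrable_const _).indicator hs
  calc ∫ ω, Real.exp (-(lam * R ω ^ p)) ∂μ
      ≤ ∫ ω, ({ω | R ω ≤ ε}.indicator (fun _ => (1 : ℝ)) ω + Real.exp (-(lam * ε ^ p))) ∂μ := by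
        refine integral_mono (integrable_exp_neg_mul_rpow hR hR0 p hlam)
          (hi.add (integrable_const _)) fun ω => ?_
        by_cases h : R ω ≤ ε
        · have h1 : Real.exp (-(lam * R ω ^ p)) ≤ 1 :=
            Real.exp_le_one_iff.2 (by linarith [mul_nonneg hlam (Real.rpow_nonneg (hR0 ω) p)])
          simpa [h] using h1.trans (le_add_of_nonneg_right (Real.exp_pos _).le)
        · have hle : ε ^ p ≤ R ω ^ p := Real.rpow_le_rpow hε (not_le.1 h).le hp
          simpa [h] using mul_le_mul_of_nonneg_left hle hlam
    _ = μ.real {ω | R ω ≤ ε} + Real.exp (-(lam * ε ^ p)) := by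
        rw [integral_add hi (integrable_const _), integral_indicator hs]
        simp

theorem le_integral_exp_neg_mul_rpow (hR : Measurable R) (hR0 : ∀ ω, 0 ≤ R ω) {p lam : ℝ} (ε : ℝ)
    (hp : 0 ≤ p) (hlam : 0 ≤ lam) :
    Real.exp (-(lam * ε ^ p)) * μ.real {ω | R ω ≤ ε} ≤ ∫ ω, Real.exp (-(lam * R ω ^ p)) ∂μ := by
  have hs : MeasurableSet {ω | R ω ≤ ε} := measurableSet_le hR measurable_const
  calc Real.exp (-(lam * ε ^ p)) * μ.real {ω | R ω ≤ ε}
      = ∫ ω, {ω | R ω ≤ ε}.indicator (fun _ => Real.exp (-(lam * ε ^ p))) ω ∂μ := by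
        rw [integral_indicator hs]
        simp [mul_comm]
    _ ≤ ∫ ω, Real.exp (-(lam * R ω ^ p)) ∂μ := by
        refine integral_mono ((integrable_const _).indicator hs)
          (integrable_exp_neg_mul_rpow hR hR0 p hlam) fun ω => ?_
        by_cases h : R ω ≤ ε
        · have hle : R ω ^ p ≤ ε ^ p := Real.rpow_le_rpow (hR0 ω) h hp
          simpa [h] using mul_le_mul_of_nonneg_left hle hlam
        · simpa [h] using (Real.exp_pos _).le

end LaplaceTransform

theorem exp_bounds_of_neg_log_div_bounds {F G c C : ℝ} (hF0 : 0 ≤ F) (hG : 0 < G) (hc : 0 < c)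
    (h₁ : c < -Real.log F / G) (h₂ : -Real.log F / G < C) :
    F ≤ Real.exp (-(c * G)) ∧ Real.exp (-(C * G)) ≤ F := by
  have hF : 0 < F := hF0.lt_of_ne' fun h => by
    rw [h] at h₁
    simp at h₁
    linarith
  rw [lt_div_iff₀ hG] at h₁
  rw [div_lt_iff₀ hG] at h₂
  exact ⟨(Real.log_le_iff_le_exp hF).1 (by linarith),
    (Real.le_log_iff_exp_le hF).1 (by linarith)⟩

theorem statement5 {Ω : Type*} [MeasureSpace Ω] [IsProbabilityMeasure (ℙ : Measure Ω)]
    (Y : ℝ → Ω → ℝ) (hY0 : ∀ᵐ ω ∂ℙ, Y 0 ω = 0)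
    (hMeasSup : Measurable fun ω => ⨆ t ∈ Set.Icc (0:ℝ) 1, |Y t ω|)
    (hMeasRange : Measurable fun ω =>
      ⨆ s ∈ Set.Icc (0:ℝ) 1, ⨆ t ∈ Set.Icc (0:ℝ) 1, |Y t ω - Y s ω|)
    (p τ : ℝ) (hp : 0 < p) (hτ : 0 < τ)
    (hYsd : weakEquivAlong (nhdsWithin 0 (Set.Ioi 0))
      (fun ε => -Real.log ((ℙ {ω | ⨆ t ∈ Set.Icc (0:ℝ) 1, |Y t ω| ≤ ε}).toReal))
      (fun ε => ε ^ (-τ))) :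
    weakEquivAlong Filter.atTop
      (fun lam => -Real.log (∫ ω, Real.exp (-(lam *
        (⨆ s ∈ Set.Icc (0:ℝ) 1, ⨆ t ∈ Set.Icc (0:ℝ) 1, |Y t ω - Y s ω|) ^ p)) ∂ℙ))
      (fun lam => lam ^ (1 / (1 + p / τ))) := by
  set M : Ω → ℝ := fun ω => ⨆ t ∈ Set.Icc (0:ℝ) 1, |Y t ω|
  set R : Ω → ℝ := fun ω => ⨆ s ∈ Set.Icc (0:ℝ) 1, ⨆ t ∈ Set.Icc (0:ℝ) 1, |Y t ω - Y s ω|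
  have hM0 : ∀ ω, 0 ≤ M ω := fun ω => Real.biSup_nonneg fun t => abs_nonneg _
  have hR0 : ∀ ω, 0 ≤ R ω := fun ω => Real.biSup_nonneg fun s =>
    Real.biSup_nonneg fun t => abs_nonneg _
  have hMR : ∀ᵐ ω ∂ℙ, M ω ≤ R ω ∧ R ω ≤ 2 * M ω := hY0.mono fun ω h =>
    biSup_abs_le_oscillation_le (y := fun t => Y t ω) (i₀ := (0 : ℝ)) (by simp) h
  obtain ⟨c, C, hc, hlow, hup⟩ := hYsd.exists_bounds
  have hpτ : 0 < p + τ := by positivity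
  have hq : 1 / (1 + p / τ) = τ / (p + τ) := by
    field_simp
    ring
  have hq0 : 0 < τ / (p + τ) := by positivity
  rw [hq]
  -- The scale `ε = lam ^ (-1 / (p + τ))` balances `lam * ε ^ p` against `ε ^ (-τ)`.
  have hεlim : Tendsto (fun lam : ℝ => lam ^ (-(1 / (p + τ)))) atTop (nhdsWithin 0 (Ioi 0)) :=
    tendsto_nhdsWithin_iff.2 ⟨tendsto_rpow_neg_atTop (by positivity),
      (eventually_gt_atTop 0).mono fun lam h => Real.rpow_pos_of_pos h _⟩
  have hbounds : ∀ᶠ lam : ℝ in atTop,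
      Real.exp (-((2 ^ p + C) * lam ^ (τ / (p + τ)))) ≤ ∫ ω, Real.exp (-(lam * R ω ^ p)) ∂ℙ ∧
      ∫ ω, Real.exp (-(lam * R ω ^ p)) ∂ℙ ≤
        2 * Real.exp (-(min c 1 * lam ^ (τ / (p + τ)))) := by
    filter_upwards [hεlim.eventually hlow, hεlim.eventually hup, eventually_gt_atTop 0]
      with lam h₁ h₂ hlam
    set ε : ℝ := lam ^ (-(1 / (p + τ))) with hε
    set G : ℝ := lam ^ (τ / (p + τ))
    have hεpos : 0 < ε := Real.rpow_pos_of_pos hlam _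
    have hG : 0 < G := Real.rpow_pos_of_pos hlam _
    have hετ : ε ^ (-τ) = G := by
      rw [hε, ← Real.rpow_mul hlam.le]
      congr 1
      field_simp
    have hεp : lam * ε ^ p = G := by
      rw [hε, ← Real.rpow_mul hlam.le]
      nth_rewrite 1 [← Real.rpow_one lam]
      rw [← Real.rpow_add hlam]
      congr 1
      field_simp
      ring
    rw [hετ] at h₁ h₂
    obtain ⟨hFle, hleF⟩ := exp_bounds_of_neg_log_div_bounds ENNReal.toReal_nonneg hG hc h₁ h₂
    constructor
    · have hFR : (ℙ : Measure Ω).real {ω | M ω ≤ ε} ≤ (ℙ : Measure Ω).real {ω | R ω ≤ 2 * ε} := by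
        refine ENNReal.toReal_mono (measure_ne_top _ _) (measure_mono_ae ?_)
        filter_upwards [hMR] with ω hω h
        exact hω.2.trans (mul_le_mul_of_nonneg_left h two_pos.le)
      refine le_trans ?_ (le_integral_exp_neg_mul_rpow hMeasRange hR0 (2 * ε) hp.le hlam.le)
      have he : lam * (2 * ε) ^ p = 2 ^ p * G := by
        rw [Real.mul_rpow two_pos.le hεpos.le, ← hεp]
        ring
      rw [he, add_mul, neg_add, Real.exp_add]
      gcongr
      exact hleF.trans hFR
    · have hRF : (ℙ : Measure Ω).real {ω | R ω ≤ ε} ≤ (ℙ : Measure Ω).real {ω | M ω ≤ ε} := by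
        refine ENNReal.toReal_mono (measure_ne_top _ _) (measure_mono_ae ?_)
        filter_upwards [hMR] with ω hω h
        exact hω.1.trans h
      refine (integral_exp_neg_mul_rpow_le hMeasRange hR0 hp.le hlam.le hεpos.le).trans ?_
      have e₁ : Real.exp (-(c * G)) ≤ Real.exp (-(min c 1 * G)) := by
        gcongr
        exact min_le_left _ _
      have e₂ : Real.exp (-G) ≤ Real.exp (-(min c 1 * G)) := by
        rw [Real.exp_le_exp, neg_le_neg_iff]
        exact mul_le_of_le_one_left hG.le (min_le_right _ _)
      rw [hεp]
      have : (ℙ : Measure Ω).real {ω | M ω ≤ ε} ≤ Real.exp (-(c * G)) := hFle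
      linarith
  have hm : 0 < min c 1 := lt_min hc one_pos
  refine weakEquivAlong_of_bounds (c := min c 1 / 2) (C := 2 ^ p + C) (by positivity) ?_ ?_
  · filter_upwards [hbounds, eventually_gt_atTop 0,
      (tendsto_rpow_atTop hq0).eventually_ge_atTop (2 * Real.log 2 / min c 1)]
      with lam ⟨hl, hu⟩ hlam hbig
    have hI := (Real.exp_pos _).trans_le hl
    rw [le_div_iff₀ (Real.rpow_pos_of_pos hlam _)]
    have hlog := Real.log_le_log hI hu
    rw [Real.log_mul two_ne_zero (Real.exp_ne_zero _), Real.log_exp] at hlog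
    rw [div_le_iff₀ hm] at hbig
    linarith
  · filter_upwards [hbounds, eventually_gt_atTop 0] with lam ⟨hl, _⟩ hlam
    rw [div_le_iff₀ (Real.rpow_pos_of_pos hlam _)]
    have hI := (Real.exp_pos _).trans_le hl
    linarith [(Real.le_log_iff_exp_le hI).2 hl]
end
end

section
/- For n ≥ 1 let τ_n := 1/(1 − 2^{−n}), and define the real sequence (d_n) by d₁ := 1 and, for n ≥ 2, d_n := d_{n−1}^{1/(1+τ_{n−1})} · (2/τ_{n−1})^{τ_{n−1}/(1+τ_{n−1})} · (1 + τ_{n−1}). Then for every n ≥ 1, d_n = (2^n − 1) / (2^{n−3} · 2^{(n+1)/(2^n − 1)}). -/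
noncomputable section

/-- `τ n = 1 / (1 - 2^{-n})`. -/
def tau (n : ℕ) : ℝ := 1 / (1 - (2:ℝ) ^ (-(n:ℝ)))

/-- The sequence `d` defined by `d 1 = 1` and the recursion
`d n = d (n-1) ^ (1/(1+τ (n-1))) * (2/τ (n-1)) ^ (τ (n-1)/(1+τ (n-1))) * (1 + τ (n-1))`. -/
def dseq : ℕ → ℝ
  | 0 => 1
  | 1 => 1
  | (n+2) => dseq (n+1) ^ (1 / (1 + tau (n+1))) *
      (2 / tau (n+1)) ^ (tau (n+1) / (1 + tau (n+1))) * (1 + tau (n+1))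

lemma one_lt_two_pow_succ (n : ℕ) : (1:ℝ) < 2 ^ (n + 1) :=
  one_lt_pow₀ one_lt_two n.succ_ne_zero

lemma tau_succ (n : ℕ) : tau (n + 1) = 2 ^ (n + 1) / (2 ^ (n + 1) - 1) := by
  have h := one_lt_two_pow_succ n
  have h1 : (2:ℝ) ^ (n + 1) - 1 ≠ 0 := by linarith
  rw [tau, Real.rpow_neg zero_le_two, Real.rpow_natCast]
  field_simp

lemma dseq_succ_pos_and_log (n : ℕ) : 0 < dseq (n + 1) ∧
    Real.log (dseq (n + 1)) = Real.log (2 ^ (n + 1) - 1) -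
      ((n:ℝ) - 2 + (n + 2) / (2 ^ (n + 1) - 1)) * Real.log 2 := by
  induction n with
  | zero => norm_num [dseq]
  | succ n ih =>
    obtain ⟨hpos, hlog⟩ := ih
    have hN := one_lt_two_pow_succ n
    have hpow : (2:ℝ) ^ (n + 1 + 1) = 2 * 2 ^ (n + 1) := pow_succ' 2 (n + 1)
    have hlogN : Real.log ((2:ℝ) ^ (n + 1)) = (n + 1) * Real.log 2 := by
      rw [Real.log_pow]; push_cast; rfl
    have htau := tau_succ n
    rw [dseq, hpow]
    generalize (2:ℝ) ^ (n + 1) = N at *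
    have hM : 0 < N - 1 := by linarith
    have hK : 0 < 2 * N - 1 := by linarith
    have hN0 : 0 < N := by linarith
    have h1 : 1 + tau (n + 1) = (2 * N - 1) / (N - 1) := by
      rw [htau]; field_simp; ring
    have h2 : 2 / tau (n + 1) = 2 * (N - 1) / N := by
      rw [htau]; field_simp
    have h3 : tau (n + 1) / (1 + tau (n + 1)) = N / (2 * N - 1) := by
      rw [h1, htau]; field_simp
    rw [h3, h2, h1]
    refine ⟨by positivity, ?_⟩
    rw [Real.log_mul (by positivity) (by positivity), Real.log_mul (by positivity) (by positivity),
      Real.log_rpow hpos, Real.log_rpow (by positivity), Real.log_div (by positivity) hN0.ne',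
      Real.log_mul two_ne_zero hM.ne', Real.log_div hK.ne' hM.ne', hlog, hlogN]
    push_cast
    field_simp
    ring

theorem statement7 (n : ℕ) (hn : 1 ≤ n) :
    dseq n = ((2:ℝ) ^ (n:ℝ) - 1) /
      ((2:ℝ) ^ ((n:ℝ) - 3) * (2:ℝ) ^ (((n:ℝ) + 1) / ((2:ℝ) ^ (n:ℝ) - 1))) := by
  obtain ⟨m, rfl⟩ := Nat.exists_eq_add_of_le' hn
  obtain ⟨hpos, hlog⟩ := dseq_succ_pos_and_log m
  have hM : (0:ℝ) < 2 ^ (m + 1) - 1 := sub_pos.2 (one_lt_two_pow_succ m)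
  rw [Real.rpow_natCast, ← Real.rpow_add two_pos]
  apply Real.log_injOn_pos hpos (div_pos hM (by positivity))
  rw [hlog, Real.log_div hM.ne' (by positivity), Real.log_rpow two_pos]
  push_cast
  ring
end
end

section
/- Let H₁, H₂ ∈ (0,1). Let X₁ be a (continuous modification of a) two-sided fractional Brownian motion with Hurst parameter H₁ and X₂ a two-sided fractional Brownian motion with Hurst parameter H₂ with continuous sample paths, defined on a common probability space and independent of each other. Let c(H₁), c(H₂) > 0 be constants such that −log P(sup_{t∈[0,1]} |X_i(t)| ≤ ε) ∼ c(H_i) ε^{−1/H_i} as ε → 0 for i = 1, 2. Then −log P(sup_{t∈[0,1]} |X₂(X₁(t))| ≤ ε) ∼ (1 + 1/H₁) · [c(H₁)^{H₁} · 2 H₁ c(H₂)]^{1/(1+H₁)} · ε^{−1/(H₂(1+H₁))} as ε → 0. -/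
open MeasureTheory ProbabilityTheory Filter Set
open scoped NNReal ENNReal

noncomputable section

variable {Ω : Type*} [MeasureSpace Ω]

/-- `B` is a fractional Brownian motion with Hurst parameter `H` on `[0,∞)`:
`B 0 = 0` and centered Gaussian finite-dimensional distributions with covariance
`(1/2)(s^{2H} + t^{2H} - |t-s|^{2H})` (characterized through one-dimensional
distributions of linear combinations). -/
def IsFBM (H : ℝ) (B : ℝ → Ω → ℝ) : Prop :=
  (∀ ω, B 0 ω = 0) ∧
  ∀ (n : ℕ) (t : Fin n → ℝ), (∀ i, 0 ≤ t i) → ∀ a : Fin n → ℝ,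
    Measure.map (fun ω => ∑ i, a i * B (t i) ω) ℙ =
      gaussianReal 0 (∑ i, ∑ j, a i * a j *
        (1/2 * ((t i) ^ (2*H) + (t j) ^ (2*H) - |t i - t j| ^ (2*H)))).toNNReal

/-- A two-sided fractional Brownian motion with Hurst parameter `H`:
`(X t)_{t ≥ 0}` and `(X (-t))_{t ≥ 0}` are independent fractional Brownian motions. -/
def IsTwoSidedFBM (H : ℝ) (X : ℝ → Ω → ℝ) : Prop :=
  IndepFun (fun ω => fun t : {t : ℝ // 0 ≤ t} => X t.1 ω)
           (fun ω => fun t : {t : ℝ // 0 ≤ t} => X (-t.1) ω) ℙ ∧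
  IsFBM H X ∧ IsFBM H (fun t ω => X (-t) ω)

/-- The one-dimensional Brunn–Minkowski inequality, for midpoints. -/
lemma volume_add_volume_le_two_mul {A B C : Set ℝ} (hA : MeasurableSet A) (hB : MeasurableSet B)
    (hA' : A.Nonempty) (hB' : B.Nonempty) (h : ∀ a ∈ A, ∀ b ∈ B, 2⁻¹ * (a + b) ∈ C) :
    volume A + volume B ≤ 2 * volume C := by
  have key (D : Set ℝ) (hD : MeasurableSet D) (hD' : D.Nonempty) :
      volume D ≤ ⨆ (K : Set ℝ) (_ : K ⊆ D ∧ IsCompact K ∧ K.Nonempty), volume K := by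
    rw [hD.measure_eq_iSup_isCompact]
    refine iSup_le fun K => iSup_le fun hK => iSup_le fun hKc => ?_
    rcases K.eq_empty_or_nonempty with rfl | hne
    · simp
    · exact le_iSup₂_of_le K ⟨hK, hKc, hne⟩ le_rfl
  refine (add_le_add (key A hA hA') (key B hB hB')).trans ?_
  obtain ⟨a, ha⟩ := hA'
  obtain ⟨b, hb⟩ := hB'
  refine ENNReal.biSup_add_biSup_le' ⟨{a}, by simpa using ha⟩ ⟨{b}, by simpa using hb⟩ ?_
  rintro K ⟨hKA, hK, hKne⟩ L ⟨hLB, hL, hLne⟩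
  have hk : sSup K ∈ K := hK.sSup_mem hKne
  have hl : sInf L ∈ L := hL.sInf_mem hLne
  have hvol (D : Set ℝ) (c : ℝ) : volume ((fun z => 2 * z) ⁻¹' ((fun z => z - c) ⁻¹' D)) =
      2⁻¹ * volume D := by
    simp only [sub_eq_add_neg]
    rw [Real.volume_preimage_mul_left (by norm_num), measure_preimage_add_right]
    simp [abs_of_pos, ENNReal.ofReal_inv_of_pos]
  have hmeas (D : Set ℝ) (c : ℝ) (hD : MeasurableSet D) :
      MeasurableSet ((fun z => 2 * z) ⁻¹' ((fun z => z - c) ⁻¹' D)) :=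
    (hD.preimage (by fun_prop)).preimage (by fun_prop)
  set K' := (fun z : ℝ => 2 * z) ⁻¹' ((fun z => z - sInf L) ⁻¹' K) with hK'
  set L' := (fun z : ℝ => 2 * z) ⁻¹' ((fun z => z - sSup K) ⁻¹' L) with hL'
  have hdisj : AEDisjoint volume K' L' := by
    refine measure_mono_null (t := {2⁻¹ * (sSup K + sInf L)}) ?_ (by simp)
    rintro z ⟨hz1, hz2⟩
    have h1 : 2 * z - sInf L ≤ sSup K := le_csSup hK.bddAbove hz1
    have h2 : sInf L ≤ 2 * z - sSup K := csInf_le hL.bddBelow hz2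
    simp only [mem_singleton_iff]
    linarith
  have hsub : K' ∪ L' ⊆ C := by
    rintro z (hz | hz)
    · have := h _ (hKA hz) _ (hLB hl)
      convert this using 1; ring
    · have := h _ (hKA hk) _ (hLB hz)
      convert this using 1; ring
  have hle := measure_mono (μ := volume) hsub
  rw [measure_union₀ (hmeas L _ hL.measurableSet).nullMeasurableSet hdisj, hvol, hvol,
    ← mul_add] at hle
  calc volume K + volume L = 2 * (2⁻¹ * (volume K + volume L)) := by
        rw [← mul_assoc, ENNReal.mul_inv_cancel (by norm_num) (by norm_num), one_mul]
    _ ≤ 2 * volume C := by gcongr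

/-- The layer-cake formula for functions with values in `[0, 1]`. -/
lemma lintegral_eq_lintegral_Ioo_meas_lt {f : ℝ → ℝ≥0∞} (hf : Measurable f) (hf1 : ∀ x, f x ≤ 1) :
    ∫⁻ x, f x = ∫⁻ s in Ioo (0 : ℝ) 1, volume {x | ENNReal.ofReal s < f x} := by
  have hne (x) : f x ≠ ∞ := ((hf1 x).trans_lt ENNReal.one_lt_top).ne
  have h1 : ∫⁻ x, f x = ∫⁻ x, ENNReal.ofReal (f x).toReal :=
    lintegral_congr fun x => (ENNReal.ofReal_toReal (hne x)).symm
  rw [h1, lintegral_eq_lintegral_meas_lt volume (Eventually.of_forall fun _ => by positivity)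
    hf.ennreal_toReal.aemeasurable, ← Ioo_union_Ici_eq_Ioi (zero_lt_one),
    lintegral_union measurableSet_Ici (Set.disjoint_left.2 fun x hx hx' => not_lt.2 hx' hx.2)]
  have h2 : ∫⁻ s in Ici (1 : ℝ), volume {x | s < (f x).toReal} = 0 := by
    rw [setLIntegral_congr_fun (g := fun _ => 0) measurableSet_Ici, lintegral_zero]
    intro s hs
    have : {x | s < (f x).toReal} = ∅ := by
      ext x
      simp only [mem_ofPred_eq, mem_empty_iff_false, iff_false, not_lt]
      exact (ENNReal.toReal_mono ENNReal.one_ne_top (hf1 x)).trans (by simpa using hs)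
    simp [this]
  rw [h2, add_zero]
  refine setLIntegral_congr_fun measurableSet_Ioo fun s hs => ?_
  simp_rw [ENNReal.ofReal_lt_iff_lt_toReal hs.1.le (hne _)]

lemma four_mul_mul_le_add_sq (x y : ℝ≥0∞) : 4 * (x * y) ≤ (x + y) ^ 2 := by
  rcases eq_or_ne x ∞ with rfl | hx
  · simp
  rcases eq_or_ne y ∞ with rfl | hy
  · simp
  lift x to ℝ≥0 using hx
  lift y to ℝ≥0 using hy
  norm_cast
  rw [← NNReal.coe_le_coe]
  push_cast
  nlinarith [sq_nonneg ((x : ℝ) - y)]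

/-- A measure satisfies the midpoint Prékopa–Leindler inequality for bounded functions. -/
def PrekopaLeindler {E : Type*} [AddCommGroup E] [Module ℝ E] [MeasurableSpace E]
    (ν : Measure E) : Prop :=
  ∀ f g h : E → ℝ≥0∞, Measurable f → Measurable g → Measurable h →
    (⨆ x, f x) ≠ ∞ → (⨆ x, g x) ≠ ∞ →
    (∀ x y, f x * g y ≤ h ((2⁻¹ : ℝ) • (x + y)) ^ 2) →
    (∫⁻ x, f x ∂ν) * (∫⁻ x, g x ∂ν) ≤ (∫⁻ x, h x ∂ν) ^ 2

lemma lintegral_add_lintegral_le_two_mul {f g h : ℝ → ℝ≥0∞} (hf : Measurable f)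
    (hg : Measurable g) (hh : Measurable h) (hf1 : ⨆ x, f x = 1) (hg1 : ⨆ x, g x = 1)
    (hfgh : ∀ x y, f x * g y ≤ h (2⁻¹ * (x + y)) ^ 2) :
    (∫⁻ x, f x) + ∫⁻ x, g x ≤ 2 * ∫⁻ x, h x := by
  have hfle (x) : f x ≤ 1 := hf1 ▸ le_iSup f x
  have hgle (x) : g x ≤ 1 := hg1 ▸ le_iSup g x
  have hmin : ∫⁻ x, min (h x) 1 ≤ ∫⁻ x, h x := lintegral_mono fun x => min_le_left _ _
  refine le_trans ?_ (mul_le_mul_right hmin 2)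
  have hanti (u : ℝ → ℝ≥0∞) : Measurable fun s : ℝ => volume {x | ENNReal.ofReal s < u x} := by
    refine Antitone.measurable fun s t hst => measure_mono fun x hx => ?_
    exact (ENNReal.ofReal_le_ofReal hst).trans_lt hx
  rw [lintegral_eq_lintegral_Ioo_meas_lt hf hfle, lintegral_eq_lintegral_Ioo_meas_lt hg hgle,
    lintegral_eq_lintegral_Ioo_meas_lt (hh.min measurable_const) (fun x => min_le_right _ _),
    ← lintegral_add_left (hanti f), ← lintegral_const_mul _ (hanti _)]
  refine setLIntegral_mono' measurableSet_Ioo fun s hs => ?_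
  have hs1 : ENNReal.ofReal s < 1 := by simpa using hs.2
  obtain ⟨x, hx⟩ := lt_iSup_iff.1 (hs1.trans_eq hf1.symm)
  obtain ⟨y, hy⟩ := lt_iSup_iff.1 (hs1.trans_eq hg1.symm)
  refine volume_add_volume_le_two_mul (measurableSet_lt measurable_const hf)
    (measurableSet_lt measurable_const hg) ⟨x, hx⟩ ⟨y, hy⟩ ?_
  intro a ha b hb
  refine lt_min ?_ hs1
  by_contra! hcon
  have h1 := (hfgh a b).trans (pow_le_pow_left₀ (zero_le) hcon 2)
  rw [sq] at h1
  exact absurd h1 (not_le.2 (ENNReal.mul_lt_mul ha hb))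

lemma prekopaLeindler_volume : PrekopaLeindler (volume : Measure ℝ) := by
  intro f g h hf hg hh hft hgt hfgh
  set a := ⨆ x, f x with ha
  set b := ⨆ x, g x with hb
  have hfa (x) : f x ≤ a := le_iSup f x
  have hgb (x) : g x ≤ b := le_iSup g x
  rcases eq_or_ne a 0 with ha0 | ha0
  · have : f = 0 := funext fun x => le_antisymm ((hfa x).trans ha0.le) (zero_le)
    simp [this]
  rcases eq_or_ne b 0 with hb0 | hb0
  · have : g = 0 := funext fun x => le_antisymm ((hgb x).trans hb0.le) (zero_le)
    simp [this]
  set r : ℝ≥0∞ := (a * b) ^ (2⁻¹ : ℝ) with hr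
  have hab0 : a * b ≠ 0 := mul_ne_zero ha0 hb0
  have habt : a * b ≠ ∞ := ENNReal.mul_ne_top hft hgt
  have hr2 : r ^ 2 = a * b := by
    rw [hr, ← ENNReal.rpow_natCast, ← ENNReal.rpow_mul]; norm_num
  have hr0 : r ≠ 0 := by rintro h0; rw [h0] at hr2; simp at hr2; tauto
  have hrt : r ≠ ∞ := by rintro h0; rw [h0] at hr2; simp at hr2; exact habt hr2.symm
  have hsc : (a * b)⁻¹ = a⁻¹ * b⁻¹ := ENNReal.mul_inv (Or.inl ha0) (Or.inl hft)
  have key := lintegral_add_lintegral_le_two_mul (f := fun x => a⁻¹ * f x)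
    (g := fun x => b⁻¹ * g x) (h := fun x => r⁻¹ * h x) (hf.const_mul _) (hg.const_mul _)
    (hh.const_mul _)
    (by rw [← ENNReal.mul_iSup, ← ha, ENNReal.inv_mul_cancel ha0 hft])
    (by rw [← ENNReal.mul_iSup, ← hb, ENNReal.inv_mul_cancel hb0 hgt])
    (by
      intro x y
      calc a⁻¹ * f x * (b⁻¹ * g y) = (a * b)⁻¹ * (f x * g y) := by rw [hsc]; ring
        _ ≤ (a * b)⁻¹ * h (2⁻¹ * (x + y)) ^ 2 := by gcongr; simpa using hfgh x y
        _ = _ := by rw [mul_pow, ← ENNReal.inv_pow, hr2])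
  rw [lintegral_const_mul _ hf, lintegral_const_mul _ hg, lintegral_const_mul _ hh] at key
  have h2 := (four_mul_mul_le_add_sq _ _).trans (pow_le_pow_left₀ (zero_le) key 2)
  have h3 : (∫⁻ x, f x) * (∫⁻ x, g x) =
      (4⁻¹ * (a * b)) * (4 * (a⁻¹ * (∫⁻ x, f x) * (b⁻¹ * ∫⁻ x, g x))) := by
    calc _ = (4⁻¹ * 4) * (a * b * (a * b)⁻¹) * ((∫⁻ x, f x) * (∫⁻ x, g x)) := by
          rw [ENNReal.inv_mul_cancel (by norm_num) (by norm_num),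
            ENNReal.mul_inv_cancel hab0 habt]; ring
      _ = _ := by rw [hsc]; ring
  have h4 : (∫⁻ x, h x) ^ 2 = (4⁻¹ * (a * b)) * (2 * (r⁻¹ * ∫⁻ x, h x)) ^ 2 := by
    calc _ = (4⁻¹ * 4) * (a * b * (a * b)⁻¹) * (∫⁻ x, h x) ^ 2 := by
          rw [ENNReal.inv_mul_cancel (by norm_num) (by norm_num),
            ENNReal.mul_inv_cancel hab0 habt]; ring
      _ = _ := by rw [← hr2, ENNReal.inv_pow]; ring
  rw [h3, h4]
  gcongr

lemma PrekopaLeindler.map {E F : Type*} [AddCommGroup E] [Module ℝ E] [MeasurableSpace E]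
    [AddCommGroup F] [Module ℝ F] [MeasurableSpace F] {ν : Measure E} (hν : PrekopaLeindler ν)
    (L : E →ₗ[ℝ] F) (hL : Measurable L) : PrekopaLeindler (ν.map L) := by
  intro f g h hf hg hh hft hgt hfgh
  rw [lintegral_map hf hL, lintegral_map hg hL, lintegral_map hh hL]
  refine hν _ _ _ (hf.comp hL) (hg.comp hL) (hh.comp hL)
    (ne_top_of_le_ne_top hft (iSup_comp_le f L)) (ne_top_of_le_ne_top hgt (iSup_comp_le g L)) ?_
  intro x y
  simpa using hfgh (L x) (L y)

lemma PrekopaLeindler.prod {E F : Type*} [AddCommGroup E] [Module ℝ E] [MeasurableSpace E]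
    [AddCommGroup F] [Module ℝ F] [MeasurableSpace F] {μ : Measure E} {ν : Measure F}
    [IsProbabilityMeasure ν] [SFinite μ] (hμ : PrekopaLeindler μ) (hν : PrekopaLeindler ν) :
    PrekopaLeindler (μ.prod ν) := by
  intro f g h hf hg hh hft hgt hfgh
  have hsec (u : E × F → ℝ≥0∞) (x : E) : ⨆ y, u (x, y) ≤ ⨆ p, u p := iSup_comp_le u _
  have hint (u : E × F → ℝ≥0∞) : ⨆ x, ∫⁻ y, u (x, y) ∂ν ≤ ⨆ p, u p := by
    refine iSup_le fun x => (lintegral_mono fun y => le_iSup u (x, y)).trans ?_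
    simp
  rw [lintegral_prod _ hf.aemeasurable, lintegral_prod _ hg.aemeasurable,
    lintegral_prod _ hh.aemeasurable]
  refine hμ _ _ _ hf.lintegral_prod_right' hg.lintegral_prod_right' hh.lintegral_prod_right'
    (ne_top_of_le_ne_top hft (hint f)) (ne_top_of_le_ne_top hgt (hint g)) ?_
  intro x x'
  refine hν _ _ _ (hf.comp measurable_prodMk_left) (hg.comp measurable_prodMk_left)
    (hh.comp measurable_prodMk_left) (ne_top_of_le_ne_top hft (hsec f x))
    (ne_top_of_le_ne_top hgt (hsec g x')) ?_
  intro y y'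
  simpa using hfgh (x, y) (x', y')

lemma prekopaLeindler_gaussianReal_zero_one : PrekopaLeindler (gaussianReal 0 1) := by
  intro f g h hf hg hh hft hgt hfgh
  have hm := measurable_gaussianPDF 0 1
  have hbd (x) : gaussianPDF 0 1 x ≤ 1 := by
    rw [gaussianPDF, ENNReal.ofReal_le_one, gaussianPDFReal]
    have h1 : (√(2 * Real.pi * (1 : ℝ≥0)))⁻¹ ≤ 1 := by
      refine inv_le_one_of_one_le₀ (Real.one_le_sqrt.2 ?_)
      have := Real.pi_gt_three
      simp; linarith
    refine mul_le_one₀ h1 (by positivity) (Real.exp_le_one_iff.2 ?_)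
    simp only [sub_zero, NNReal.coe_one, mul_one]
    have := sq_nonneg x
    linarith
  have hsup (u : ℝ → ℝ≥0∞) : ⨆ x, gaussianPDF 0 1 x * u x ≤ ⨆ x, u x :=
    iSup_mono fun x => (mul_le_mul_left (hbd x) _).trans (one_mul _).le
  have hpdf (x y : ℝ) : gaussianPDF 0 1 x * gaussianPDF 0 1 y ≤
      gaussianPDF 0 1 ((2⁻¹ : ℝ) • (x + y)) ^ 2 := by
    rw [sq]
    simp only [gaussianPDF]
    rw [← ENNReal.ofReal_mul (gaussianPDFReal_nonneg _ _ _),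
      ← ENNReal.ofReal_mul (gaussianPDFReal_nonneg _ _ _)]
    refine ENNReal.ofReal_le_ofReal ?_
    simp only [gaussianPDFReal]
    rw [mul_mul_mul_comm, mul_mul_mul_comm (√_)⁻¹ (Real.exp _) (√_)⁻¹, ← Real.exp_add,
      ← Real.exp_add]
    refine mul_le_mul_of_nonneg_left (Real.exp_le_exp.2 ?_) (by positivity)
    simp only [sub_zero, NNReal.coe_one, mul_one, smul_eq_mul]
    nlinarith [sq_nonneg (x - y)]
  rw [gaussianReal_of_var_ne_zero _ one_ne_zero, lintegral_withDensity_eq_lintegral_mul _ hm hf,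
    lintegral_withDensity_eq_lintegral_mul _ hm hg, lintegral_withDensity_eq_lintegral_mul _ hm hh]
  refine prekopaLeindler_volume _ _ _ (hm.mul hf) (hm.mul hg) (hm.mul hh)
    (ne_top_of_le_ne_top hft (hsup f)) (ne_top_of_le_ne_top hgt (hsup g)) ?_
  intro x y
  simp only [Pi.mul_apply]
  rw [mul_mul_mul_comm, mul_pow]
  exact mul_le_mul' (hpdf x y) (hfgh x y)

lemma prekopaLeindler_pi_gaussianReal (n : ℕ) :
    PrekopaLeindler (Measure.pi fun _ : Fin n => gaussianReal 0 1) := by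
  induction n with
  | zero =>
    intro f g h _ _ _ _ _ hfgh
    have := hfgh 0 0
    simp only [lintegral_unique, measure_univ, mul_one]
    convert this using 2 <;> congr 1 <;> exact Subsingleton.elim _ _
  | succ n ih =>
    have h := (measurePreserving_piFinSuccAbove (fun _ : Fin (n + 1) => gaussianReal 0 1) 0).symm
    rw [← h.map_eq]
    let L : ℝ × (Fin n → ℝ) →ₗ[ℝ] (Fin (n + 1) → ℝ) :=
      { toFun := (MeasurableEquiv.piFinSuccAbove (fun _ : Fin (n + 1) => ℝ) 0).symm
        map_add' := by
          intro x y
          ext i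
          refine Fin.cases ?_ (fun i => ?_) i <;> simp [MeasurableEquiv.piFinSuccAbove]
        map_smul' := by
          intro c x
          ext i
          refine Fin.cases ?_ (fun i => ?_) i <;> simp [MeasurableEquiv.piFinSuccAbove] }
    exact PrekopaLeindler.map (prekopaLeindler_gaussianReal_zero_one.prod ih) L h.measurable

open scoped MatrixOrder in
lemma prekopaLeindler_multivariateGaussian {n : ℕ} (S : Matrix (Fin n) (Fin n) ℝ) :
    PrekopaLeindler (multivariateGaussian 0 S) := by
  have h1 : PrekopaLeindler (stdGaussian (EuclideanSpace ℝ (Fin n))) := by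
    rw [← map_pi_eq_stdGaussian]
    exact (prekopaLeindler_pi_gaussianReal n).map
      (WithLp.linearEquiv 2 ℝ (Fin n → ℝ)).symm.toLinearMap (WithLp.measurable_toLp 2 _)
  rw [multivariateGaussian]
  simp only [zero_add]
  exact h1.map (Matrix.toEuclideanCLM (𝕜 := ℝ) (CFC.sqrt S)).toLinearMap
    (ContinuousLinearMap.measurable _)

lemma eq_multivariateGaussian_of_integral_eq_zero {n : ℕ} (μ : Measure (EuclideanSpace ℝ (Fin n)))
    [IsGaussian μ] (h0 : ∫ x, x ∂μ = 0) :
    ∃ S : Matrix (Fin n) (Fin n) ℝ, μ = multivariateGaussian 0 S := by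
  let b := (EuclideanSpace.basisFun (Fin n) ℝ).toBasis
  let S : Matrix (Fin n) (Fin n) ℝ := .of fun i j => covarianceBilin μ (b i) (b j)
  have hexp (x y : EuclideanSpace ℝ (Fin n)) :
      covarianceBilin μ x y = x ⬝ᵥ S.mulVec y := by
    conv_lhs => rw [← b.sum_repr x, ← b.sum_repr y]
    simp only [map_sum, map_smul, sum_apply, smul_apply,
      smul_eq_mul, dotProduct, Matrix.mulVec, Finset.mul_sum, S, Matrix.of_apply]
    rw [Finset.sum_comm]
    refine Finset.sum_congr rfl fun i _ => Finset.sum_congr rfl fun j _ => ?_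
    simp [b]; ring
  have hS : S.PosSemidef := by
    refine Matrix.PosSemidef.of_dotProduct_mulVec_nonneg ?_ fun x => ?_
    · ext i j
      simp [S, covarianceBilin_comm]
    · have := hexp (WithLp.toLp 2 x) (WithLp.toLp 2 x)
      simp only [star_trivial]
      rw [← this]
      exact covarianceBilin_self_nonneg _
  refine ⟨S, IsGaussian.ext (by simp [h0]) ?_⟩
  ext x y
  rw [hexp, covarianceBilin_multivariateGaussian hS]

lemma map_pi_eq_of_forall_map_sum_eq {Ω' : Type*} [MeasurableSpace Ω'] {P : Measure Ω'}
    [IsProbabilityMeasure P] {n : ℕ} {Y Z : Fin n → Ω' → ℝ} (hY : ∀ i, AEMeasurable (Y i) P)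
    (hZ : ∀ i, AEMeasurable (Z i) P)
    (h : ∀ a : Fin n → ℝ, P.map (fun ω => ∑ i, a i * Y i ω) = P.map (fun ω => ∑ i, a i * Z i ω)) :
    P.map (fun ω i => Y i ω) = P.map (fun ω i => Z i ω) := by
  have hY' : AEMeasurable (fun ω i => Y i ω) P := aemeasurable_pi_lambda _ hY
  have hZ' : AEMeasurable (fun ω i => Z i ω) P := aemeasurable_pi_lambda _ hZ
  have := Measure.isProbabilityMeasure_map hY'
  have := Measure.isProbabilityMeasure_map hZ'
  refine Measure.ext_of_charFunDual ?_
  ext L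
  have key (W : Fin n → Ω' → ℝ) (hW : AEMeasurable (fun ω i => W i ω) P) :
      (P.map fun ω i => W i ω).map L = P.map fun ω => ∑ i, L (Pi.single i 1) * W i ω := by
    rw [AEMeasurable.map_map_of_aemeasurable L.measurable.aemeasurable hW]
    congr 1
    ext ω
    have := LinearMap.pi_apply_eq_sum_univ L.toLinearMap (fun i => W i ω)
    simp only [ContinuousLinearMap.coe_coe, smul_eq_mul] at this
    simp only [Function.comp_apply, this]
    refine Finset.sum_congr rfl fun i _ => ?_
    rw [mul_comm]
    congr 2
    ext j
    simp [Pi.single_apply, eq_comm]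
  rw [charFunDual_eq_charFun_map_one, charFunDual_eq_charFun_map_one, key Y hY', key Z hZ', h]

/-- **Anderson's inequality** for constant shifts of a centered Gaussian vector and cubes. -/
lemma measure_forall_abs_sub_le_le {Ω' : Type*} [MeasurableSpace Ω'] {P : Measure Ω'}
    [IsProbabilityMeasure P] {n : ℕ} {Y : Fin n → Ω' → ℝ}
    (hY : ∀ a : Fin n → ℝ, ∃ v, P.map (fun ω => ∑ i, a i * Y i ω) = gaussianReal 0 v) (x b : ℝ) :
    P {ω | ∀ i, |Y i ω - x| ≤ b} ≤ P {ω | ∀ i, |Y i ω| ≤ b} := by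
  have hmeas (i) : AEMeasurable (Y i) P := by
    obtain ⟨v, hv⟩ := hY (Pi.single i 1)
    have : (fun ω => ∑ j, (Pi.single i 1 : Fin n → ℝ) j * Y j ω) = Y i := by
      ext ω; simp [Pi.single_apply]
    rw [this] at hv
    refine AEMeasurable.of_map_ne_zero ?_
    rw [hv]
    exact IsProbabilityMeasure.ne_zero _
  set V : Ω' → (Fin n → ℝ) := fun ω i => Y i ω with hV
  have hVm : AEMeasurable V P := aemeasurable_pi_lambda _ hmeas
  have hbox (x : ℝ) : MeasurableSet {y : Fin n → ℝ | ∀ i, |y i - x| ≤ b} := by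
    measurability
  have hneg : P.map V = P.map (fun ω i => - Y i ω) := by
    refine map_pi_eq_of_forall_map_sum_eq hmeas (fun i => (hmeas i).neg) fun a => ?_
    obtain ⟨v, hv⟩ := hY a
    have h1 : (fun ω => ∑ i, a i * - Y i ω) = (fun z => -z) ∘ fun ω => ∑ i, a i * Y i ω := by
      ext ω; simp
    rw [h1, ← AEMeasurable.map_map_of_aemeasurable (by fun_prop)
      (Finset.aemeasurable_fun_sum _ fun i _ => (hmeas i).const_mul _), hv, gaussianReal_map_neg,
      neg_zero]
  have hsymm : P {ω | ∀ i, |Y i ω - (-x)| ≤ b} = P {ω | ∀ i, |Y i ω - x| ≤ b} := by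
    have h1 := Measure.map_apply_of_aemeasurable hVm (hbox x)
    have hVn : AEMeasurable (fun ω i => -Y i ω) P := hVm.neg
    rw [hneg, Measure.map_apply_of_aemeasurable hVn (hbox x)] at h1
    rw [show {ω | ∀ i, |Y i ω - x| ≤ b} = V ⁻¹' {y | ∀ i, |y i - x| ≤ b} from rfl, ← h1]
    congr 1
    ext ω
    refine forall_congr' fun i => ?_
    rw [← abs_neg, neg_sub', neg_neg, sub_eq_add_neg]
  let T : (Fin n → ℝ) → EuclideanSpace ℝ (Fin n) := WithLp.toLp 2
  have hT : Measurable T := WithLp.measurable_toLp 2 _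
  have hTV : AEMeasurable (fun ω => T (V ω)) P := hT.comp_aemeasurable hVm
  set μ := P.map (fun ω => T (V ω)) with hμ
  have : IsProbabilityMeasure μ := Measure.isProbabilityMeasure_map hTV
  have hdual (L : StrongDual ℝ (EuclideanSpace ℝ (Fin n))) : ∃ v, μ.map L = gaussianReal 0 v := by
    obtain ⟨v, hv⟩ := hY (fun i => L (EuclideanSpace.single i 1))
    refine ⟨v, ?_⟩
    rw [hμ, AEMeasurable.map_map_of_aemeasurable L.measurable.aemeasurable hTV, ← hv]
    congr 1
    ext ω
    have h1 : T (V ω) = ∑ i, Y i ω • EuclideanSpace.single i (1 : ℝ) := by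
      ext j
      simp [T, V, Pi.single_apply]
    simp only [Function.comp_apply, h1, map_sum, map_smul, smul_eq_mul]
    exact Finset.sum_congr rfl fun i _ => mul_comm _ _
  have : IsGaussian μ := isGaussian_of_map_eq_gaussianReal fun L => ⟨0, hdual L⟩
  have h0 : ∫ y, y ∂μ = 0 := by
    refine SeparatingDual.eq_zero_of_forall_dual_eq_zero (R := ℝ) fun L => ?_
    obtain ⟨v, hv⟩ := hdual L
    rw [← L.integral_comp_id_comm IsGaussian.integrable_id,
      ← integral_map (φ := L) (f := fun z => z) L.measurable.aemeasurable
      (by fun_prop), hv, integral_id_gaussianReal]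
  obtain ⟨S, hS⟩ := eq_multivariateGaussian_of_integral_eq_zero μ h0
  have hPL : PrekopaLeindler μ := hS ▸ prekopaLeindler_multivariateGaussian S
  let B (x : ℝ) : Set (EuclideanSpace ℝ (Fin n)) := {y | ∀ i, |y i - x| ≤ b}
  have hB (x : ℝ) : MeasurableSet (B x) := by
    have : B x = (WithLp.ofLp) ⁻¹' {y : Fin n → ℝ | ∀ i, |y i - x| ≤ b} := rfl
    rw [this]
    exact (hbox x).preimage (WithLp.measurable_ofLp 2 _)
  have hPB (x : ℝ) : μ (B x) = P {ω | ∀ i, |Y i ω - x| ≤ b} :=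
    Measure.map_apply_of_aemeasurable hTV (hB x)
  have hind (s : Set (EuclideanSpace ℝ (Fin n))) :
      (⨆ y, s.indicator (1 : EuclideanSpace ℝ (Fin n) → ℝ≥0∞) y) ≠ ∞ :=
    ne_top_of_le_ne_top ENNReal.one_ne_top
      (iSup_le fun y => Set.indicator_le_self' (fun _ _ => zero_le) y)
  have key := hPL ((B x).indicator 1) ((B (-x)).indicator 1) ((B 0).indicator 1)
    (measurable_one.indicator (hB x)) (measurable_one.indicator (hB _))
    (measurable_one.indicator (hB _)) (hind _) (hind _) (by
      intro y z
      by_cases hy : y ∈ B x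
      · by_cases hz : z ∈ B (-x)
        · have hyz : (2⁻¹ : ℝ) • (y + z) ∈ B 0 := by
            intro i
            have h1 := abs_le.1 (hy i)
            have h2 := abs_le.1 (hz i)
            simp only [PiLp.smul_apply, PiLp.add_apply, smul_eq_mul, sub_zero]
            rw [abs_le]
            constructor <;> linarith
          rw [Set.indicator_of_mem hy, Set.indicator_of_mem hz, Set.indicator_of_mem hyz]
          simp
        · simp [hz]
      · simp [hy])
  rw [lintegral_indicator_one (hB _), lintegral_indicator_one (hB _),
    lintegral_indicator_one (hB _), hPB, hPB, hPB, hsymm, ← sq] at key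
  have := (ENNReal.pow_right_strictMono two_ne_zero).le_iff_le.1 key
  simpa using this

lemma exists_exp_le_and_le_exp_of_strongEquiv {p : ℝ → ℝ} {c α η : ℝ} (hp : ∀ x, 0 ≤ p x)
    (hc : 0 < c) (hη : η ∈ Ioo (0 : ℝ) 1)
    (h : strongEquiv (fun ε => -Real.log (p ε)) (fun ε => c * ε ^ (-α))) :
    ∃ x₀ > 0, ∀ x ∈ Ioo 0 x₀, Real.exp (-((1 + η) * (c * x ^ (-α)))) ≤ p x ∧
      p x ≤ Real.exp (-((1 - η) * (c * x ^ (-α)))) := by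
  have h1 := h.eventually (Ioo_mem_nhds (by linarith [hη.1] : 1 - η < 1)
    (by linarith [hη.1] : 1 < 1 + η))
  obtain ⟨x₀, hx₀, hsub⟩ := mem_nhdsGT_iff_exists_Ioo_subset.1 h1
  refine ⟨x₀, hx₀, fun x hx => ?_⟩
  have hg : 0 < c * x ^ (-α) := mul_pos hc (Real.rpow_pos_of_pos hx.1 _)
  obtain ⟨h2, h3⟩ := hsub hx
  rw [lt_div_iff₀ hg] at h2
  rw [div_lt_iff₀ hg] at h3
  beta_reduce at h2 h3
  have hpos : 0 < p x := by
    refine (hp x).lt_of_ne' fun h0 => ?_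
    rw [h0, Real.log_zero, neg_zero] at h2
    have := mul_pos (sub_pos.2 hη.2) hg
    linarith
  rw [← Real.le_log_iff_exp_le hpos, ← Real.log_le_iff_le_exp hpos]
  constructor <;> linarith

lemma exists_forall_le_mul_exp_of_strongEquiv {p : ℝ → ℝ} {c α η : ℝ} (hp : ∀ x, 0 ≤ p x)
    (hp1 : ∀ x, p x ≤ 1) (hc : 0 < c) (hα : 0 < α) (hη : η ∈ Ioo (0 : ℝ) 1)
    (h : strongEquiv (fun ε => -Real.log (p ε)) (fun ε => c * ε ^ (-α))) :
    ∃ C ≥ 1, ∀ x > 0, p x ≤ C * Real.exp (-((1 - η) * (c * x ^ (-α)))) := by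
  obtain ⟨x₀, hx₀, hb⟩ := exists_exp_le_and_le_exp_of_strongEquiv hp hc hη h
  have hη' : 0 < 1 - η := sub_pos.2 hη.2
  have hC : 1 ≤ Real.exp ((1 - η) * (c * x₀ ^ (-α))) := Real.one_le_exp (by positivity)
  refine ⟨_, hC, fun x hx => ?_⟩
  rcases lt_or_ge x x₀ with hlt | hge
  · exact (hb x ⟨hx, hlt⟩).2.trans (le_mul_of_one_le_left (Real.exp_pos _).le hC)
  · refine (hp1 x).trans ?_
    rw [← Real.exp_add]
    refine Real.one_le_exp ?_
    have h1 : x ^ (-α) ≤ x₀ ^ (-α) := Real.rpow_le_rpow_of_nonpos hx₀ hge (by linarith)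
    have h2 := mul_le_mul_of_nonneg_left (mul_le_mul_of_nonneg_left h1 hc.le) hη'.le
    linarith

lemma strongEquiv_of_forall_exp_bounds {p g : ℝ → ℝ} (hg : ∀ ε > 0, 0 < g ε)
    (h : ∀ κ ∈ Ioo (0 : ℝ) 1, ∀ᶠ ε in nhdsWithin 0 (Ioi 0),
      Real.exp (-((1 + κ) * g ε)) ≤ p ε ∧ p ε ≤ Real.exp (-((1 - κ) * g ε))) :
    strongEquiv (fun ε => -Real.log (p ε)) g := by
  refine Metric.tendsto_nhds.2 fun e he => ?_
  have hκ : min (e / 2) 2⁻¹ ∈ Ioo (0 : ℝ) 1 :=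
    ⟨by positivity, (min_le_right _ _).trans_lt (by norm_num)⟩
  filter_upwards [h _ hκ, self_mem_nhdsWithin] with ε hε hε0
  have hgε := hg ε hε0
  have hpos : 0 < p ε := (Real.exp_pos _).trans_le hε.1
  rw [← Real.le_log_iff_exp_le hpos, ← Real.log_le_iff_le_exp hpos] at hε
  refine lt_of_le_of_lt ?_ (half_lt_self he)
  refine le_trans ?_ (min_le_left _ 2⁻¹)
  rw [Real.dist_eq, abs_le, le_sub_iff_add_le, sub_le_iff_le_add, le_div_iff₀ hgε, div_le_iff₀ hgε]
  constructor <;> linarith [hε.1, hε.2]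

/-- The balance equations that define the optimal range `r` of the inner process, and the value `V`
of the resulting exponential cost. -/
lemma exists_balance {H₁ c₁ c₂ l : ℝ} (hH₁ : 0 < H₁) (hc₁ : 0 < c₁) (hc₂ : 0 < c₂) (hl : 0 < l) :
    ∃ r > 0,
      c₂ * l * r = (1 + 1 / H₁) * (c₁ ^ H₁ * (2 * H₁ * c₂)) ^ (1 / (1 + H₁)) *
        l ^ (1 / (1 + H₁)) / (1 + H₁) ∧
      c₁ * (r / 2) ^ (-(1 / H₁)) = (1 + 1 / H₁) * (c₁ ^ H₁ * (2 * H₁ * c₂)) ^ (1 / (1 + H₁)) *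
        l ^ (1 / (1 + H₁)) * H₁ / (1 + H₁) := by
  have h1 : 0 < 1 + H₁ := by positivity
  have h2 : 1 + 1 / H₁ = (1 + H₁) / H₁ := by field_simp; ring
  refine ⟨2 * (c₁ / (2 * H₁ * c₂ * l)) ^ (H₁ / (1 + H₁)), by positivity, ?_, ?_⟩
  · refine Real.log_injOn_pos (by simp; positivity) (by simp; positivity) ?_
    rw [h2]
    repeat first
      | rw [Real.log_mul (by positivity) (by positivity)]
      | rw [Real.log_div (by positivity) (by positivity)]
      | rw [Real.log_rpow (by positivity)]
    field_simp
    ring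
  · rw [mul_div_cancel_left₀ _ two_ne_zero]
    refine Real.log_injOn_pos (by simp; positivity) (by simp; positivity) ?_
    rw [h2]
    repeat first
      | rw [Real.log_mul (by positivity) (by positivity)]
      | rw [Real.log_div (by positivity) (by positivity)]
      | rw [Real.log_rpow (by positivity)]
    field_simp
    ring

lemma le_add_of_balance {H V A B r s : ℝ} (hH : 0 < H) (hV : 0 ≤ V) (hr : 0 < r)
    (hs : 0 < s) (hA : A * r = V / (1 + H)) (hB : B * (r / 2) ^ (-(1 / H)) = V * H / (1 + H)) :
    V ≤ A * s + B * (s / 2) ^ (-(1 / H)) := by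
  have hx : 0 < s / r := by positivity
  have h1 : 1 - (s / r - 1) / H ≤ (s / r) ^ (-(1 / H)) := by
    rw [Real.rpow_def_of_pos hx]
    have h2 := Real.add_one_le_exp (Real.log (s / r) * -(1 / H))
    have h3 : Real.log (s / r) / H ≤ (s / r - 1) / H := by
      gcongr; exact Real.log_le_sub_one_of_pos hx
    have h4 : Real.log (s / r) * -(1 / H) = - (Real.log (s / r) / H) := by ring
    linarith
  have h5 : A * s = V / (1 + H) * (s / r) := by rw [← hA]; field_simp
  have h6 : B * (s / 2) ^ (-(1 / H)) = V * H / (1 + H) * (s / r) ^ (-(1 / H)) := by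
    rw [← hB, mul_assoc, ← Real.mul_rpow (by positivity) (by positivity)]
    congr 2
    field_simp
  have h7 : V * H / (1 + H) * (1 - (s / r - 1) / H) ≤ V * H / (1 + H) * (s / r) ^ (-(1 / H)) := by
    gcongr
  have h8 : V * H / (1 + H) * (1 - (s / r - 1) / H) = V - V / (1 + H) * (s / r) := by
    field_simp; ring
  rw [h5, h6]
  linarith

/-- The analytic part: small deviations of an iterated process from two-sided estimates in terms
of the small ball probabilities `p₁`, `p₂` of its components. -/
lemma strongEquiv_of_iterated_bounds {H₁ H₂ c₁ c₂ : ℝ} (hH₁ : 0 < H₁) (hH₂ : 0 < H₂)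
    (hc₁ : 0 < c₁) (hc₂ : 0 < c₂) {p₁ p₂ q : ℝ → ℝ} {ψ : ℝ → ℝ → ℝ}
    (hp₁ : ∀ x, 0 ≤ p₁ x) (hp₁' : ∀ x, p₁ x ≤ 1) (hp₂ : ∀ x, 0 ≤ p₂ x) (hp₂' : ∀ x, p₂ x ≤ 1)
    (hψ0 : ∀ ε a, 0 ≤ ψ ε a) (hψ1 : ∀ ε a, ψ ε a ≤ 1)
    (hψ : ∀ ε > 0, ∀ a > 0, ψ ε a = p₂ (ε / a ^ H₂))
    (h₁ : strongEquiv (fun ε => -Real.log (p₁ ε)) (fun ε => c₁ * ε ^ (-(1 / H₁))))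
    (h₂ : strongEquiv (fun ε => -Real.log (p₂ ε)) (fun ε => c₂ * ε ^ (-(1 / H₂))))
    (hlow : ∀ ε > 0, ∀ ρ > 0, p₁ ρ * (ψ ε ρ * ψ ε ρ) ≤ q ε)
    (hup : ∀ ε > 0, ∀ δ > 0, ∀ N : ℕ, q ε ≤
      (∑ k ∈ Finset.range N, ∑ j ∈ Finset.range N,
        p₁ ((k + j + 2) * δ / 2) * (ψ ε (k * δ) * ψ ε (j * δ))) + 2 * ψ ε (N * δ)) :
    strongEquiv (fun ε => -Real.log (q ε))
      (fun ε => (1 + 1 / H₁) * (c₁ ^ H₁ * (2 * H₁ * c₂)) ^ (1 / (1 + H₁)) *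
        ε ^ (-(1 / (H₂ * (1 + H₁))))) := by
  set G : ℝ → ℝ := fun ε => (1 + 1 / H₁) * (c₁ ^ H₁ * (2 * H₁ * c₂)) ^ (1 / (1 + H₁)) *
    ε ^ (-(1 / (H₂ * (1 + H₁)))) with hG
  have hG0 (ε : ℝ) (hε : 0 < ε) : 0 < G ε := by positivity
  have hGtop : Tendsto G (nhdsWithin 0 (Ioi 0)) atTop :=
    (tendsto_rpow_neg_nhdsGT_zero (by rw [neg_lt_zero]; positivity)).const_mul_atTop (by positivity)
  have hbal (ε : ℝ) (hε : 0 < ε) : ∃ r > 0, c₂ * ε ^ (-(1 / H₂)) * r = G ε / (1 + H₁) ∧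
      c₁ * (r / 2) ^ (-(1 / H₁)) = G ε * H₁ / (1 + H₁) := by
    have h := exists_balance hH₁ hc₁ hc₂ (Real.rpow_pos_of_pos hε (-(1 / H₂)))
    rw [← Real.rpow_mul hε.le, show -(1 / H₂) * (1 / (1 + H₁)) = -(1 / (H₂ * (1 + H₁))) by
      field_simp] at h
    exact h
  have hsc (ε a : ℝ) (hε : 0 < ε) (ha : 0 < a) :
      (ε / a ^ H₂) ^ (-(1 / H₂)) = ε ^ (-(1 / H₂)) * a := by
    rw [Real.div_rpow hε.le (by positivity), ← Real.rpow_mul ha.le,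
      show H₂ * -(1 / H₂) = -1 by field_simp, Real.rpow_neg_one, div_inv_eq_mul]
  refine strongEquiv_of_forall_exp_bounds hG0 fun κ hκ => ?_
  refine Filter.Eventually.and ?_ ?_
  · obtain ⟨x₁, hx₁, hb₁⟩ := exists_exp_le_and_le_exp_of_strongEquiv hp₁ hc₁ hκ h₁
    obtain ⟨x₂, hx₂, hb₂⟩ := exists_exp_le_and_le_exp_of_strongEquiv hp₂ hc₂ hκ h₂
    filter_upwards [self_mem_nhdsWithin,
      hGtop.eventually_gt_atTop (c₁ * x₁ ^ (-(1 / H₁)) * (1 + H₁) / H₁),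
      hGtop.eventually_gt_atTop (2 * c₂ * x₂ ^ (-(1 / H₂)) * (1 + H₁))] with ε hε hG1 hG2
    have hε : 0 < ε := hε
    obtain ⟨r, hr, hr1, hr2⟩ := hbal ε hε
    have hr' : 0 < r / 2 := by positivity
    have hlt1 : r / 2 < x₁ := by
      rw [← Real.rpow_lt_rpow_iff_of_neg hx₁ hr' (by rw [neg_lt_zero]; positivity : -(1 / H₁) < 0)]
      rw [div_lt_iff₀ hH₁] at hG1
      have : c₁ * x₁ ^ (-(1 / H₁)) < c₁ * (r / 2) ^ (-(1 / H₁)) := by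
        rw [hr2, lt_div_iff₀ (by positivity)]; exact hG1
      exact lt_of_mul_lt_mul_left this hc₁.le
    have hx : 0 < ε / (r / 2) ^ H₂ := by positivity
    have hlt2 : ε / (r / 2) ^ H₂ < x₂ := by
      rw [← Real.rpow_lt_rpow_iff_of_neg hx₂ hx (by rw [neg_lt_zero]; positivity : -(1 / H₂) < 0),
        hsc _ _ hε hr']
      have : c₂ * x₂ ^ (-(1 / H₂)) * 2 < c₂ * ε ^ (-(1 / H₂)) * r := by
        rw [hr1, lt_div_iff₀ (by positivity)]; linarith
      have : c₂ * x₂ ^ (-(1 / H₂)) < c₂ * (ε ^ (-(1 / H₂)) * (r / 2)) := by linarith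
      exact lt_of_mul_lt_mul_left this hc₂.le
    refine le_trans ?_ (hlow ε hε (r / 2) hr')
    have e1 := (hb₁ _ ⟨hr', hlt1⟩).1
    have e2 := (hb₂ _ ⟨hx, hlt2⟩).1
    rw [← hψ ε hε _ hr', hsc _ _ hε hr'] at e2
    calc Real.exp (-((1 + κ) * G ε)) = Real.exp (-((1 + κ) * (c₁ * (r / 2) ^ (-(1 / H₁))))) *
          (Real.exp (-((1 + κ) * (c₂ * (ε ^ (-(1 / H₂)) * (r / 2))))) *
          Real.exp (-((1 + κ) * (c₂ * (ε ^ (-(1 / H₂)) * (r / 2)))))) := by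
          rw [← Real.exp_add, ← Real.exp_add]
          congr 1
          have : c₁ * (r / 2) ^ (-(1 / H₁)) + c₂ * ε ^ (-(1 / H₂)) * r = G ε := by
            rw [hr1, hr2]; field_simp; ring
          rw [← this]; ring
      _ ≤ _ := by
          gcongr
          · exact hp₁ _
          · exact hψ0 _ _
  · set η := κ / 3 with hη_def
    have hη : η ∈ Ioo (0 : ℝ) 1 := ⟨by linarith [hκ.1], by linarith [hκ.1, hκ.2]⟩
    obtain ⟨C₁, hC₁, hb₁⟩ := exists_forall_le_mul_exp_of_strongEquiv hp₁ hp₁' hc₁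
      (by positivity) hη h₁
    obtain ⟨C₂, hC₂, hb₂⟩ := exists_forall_le_mul_exp_of_strongEquiv hp₂ hp₂' hc₂
      (by positivity) hη h₂
    obtain ⟨N, hN⟩ := exists_nat_gt (6 / κ)
    have hN0 : (0 : ℝ) < N := lt_trans (div_pos (by norm_num) hκ.1) hN
    have hNκ : 2 / (N : ℝ) ≤ κ / 3 := by
      rw [div_lt_iff₀ hκ.1] at hN
      rw [div_le_div_iff₀ hN0 (by norm_num)]; linarith
    set D : ℝ := N * (N * (C₁ * (C₂ * C₂))) + 2 * C₂ with hD
    have hD0 : 0 < D := by positivity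
    filter_upwards [self_mem_nhdsWithin, hGtop.eventually_ge_atTop (Real.log D / (κ / 3))]
      with ε hε hGD
    have hε : 0 < ε := hε
    obtain ⟨r, hr, hr1, hr2⟩ := hbal ε hε
    have hGε := hG0 ε hε
    set l := ε ^ (-(1 / H₂)) with hl
    have hl0 : 0 < l := Real.rpow_pos_of_pos hε _
    have hη1 : 0 < 1 - η := sub_pos.2 hη.2
    have hψb (a : ℝ) (ha : 0 ≤ a) : ψ ε a ≤ C₂ * Real.exp (-((1 - η) * (c₂ * (l * a)))) := by
      rcases ha.eq_or_lt with rfl | ha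
      · simpa using (hψ1 ε 0).trans hC₂
      · rw [hψ ε hε a ha, ← hsc ε a hε ha]
        exact hb₂ _ (by positivity)
    set δ := G ε / (N * (c₂ * l)) with hδ
    have hδ0 : 0 < δ := by positivity
    have hδN : c₂ * (l * (N * δ)) = G ε := by rw [hδ]; field_simp
    have hδ1 : c₂ * (l * δ) = G ε / N := by rw [hδ]; field_simp
    set R := Real.exp (-((1 - 2 * (κ / 3)) * G ε)) with hR
    have hterm (k j : ℕ) : p₁ ((k + j + 2) * δ / 2) * (ψ ε (k * δ) * ψ ε (j * δ)) ≤
        C₁ * (C₂ * C₂) * R := by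
      have hs : 0 < ((k : ℝ) + j + 2) * δ := by positivity
      have hV := le_add_of_balance hH₁ hGε.le hr hs hr1 hr2
      calc _ ≤ (C₁ * Real.exp (-((1 - η) * (c₁ * ((k + j + 2) * δ / 2) ^ (-(1 / H₁)))))) *
            ((C₂ * Real.exp (-((1 - η) * (c₂ * (l * (k * δ)))))) *
            (C₂ * Real.exp (-((1 - η) * (c₂ * (l * (j * δ))))))) := by
            gcongr
            · exact mul_nonneg (hψ0 _ _) (hψ0 _ _)
            · exact hb₁ _ (by positivity)
            · exact hψ0 _ _
            · exact hψb _ (by positivity)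
            · exact hψb _ (by positivity)
        _ = C₁ * (C₂ * C₂) * Real.exp (-((1 - η) * (c₂ * l * ((k + j + 2) * δ) +
            c₁ * ((k + j + 2) * δ / 2) ^ (-(1 / H₁)))) + (1 - η) * (2 * (c₂ * (l * δ)))) := by
            rw [show C₁ * (C₂ * C₂) * Real.exp (-((1 - η) * (c₂ * l * ((k + j + 2) * δ) +
              c₁ * ((k + j + 2) * δ / 2) ^ (-(1 / H₁)))) + (1 - η) * (2 * (c₂ * (l * δ)))) =
              C₁ * (C₂ * C₂) * (Real.exp (-((1 - η) * (c₁ * ((k + j + 2) * δ / 2) ^ (-(1 / H₁))))) *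
              (Real.exp (-((1 - η) * (c₂ * (l * (k * δ))))) *
              Real.exp (-((1 - η) * (c₂ * (l * (j * δ))))))) by
                rw [← Real.exp_add, ← Real.exp_add]; congr 2; ring]
            ring
        _ ≤ C₁ * (C₂ * C₂) * R := by
            refine mul_le_mul_of_nonneg_left ?_ (by positivity)
            rw [hδ1, hR]
            refine Real.exp_le_exp.2 ?_
            have e1 := mul_le_mul_of_nonneg_left hV hη1.le
            have e2 : (1 - η) * (2 * (G ε / N)) ≤ κ / 3 * G ε := by
              calc (1 - η) * (2 * (G ε / N)) ≤ 1 * (2 * (G ε / N)) := by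
                    gcongr; linarith [hη.1]
                _ = 2 / N * G ε := by ring
                _ ≤ _ := by gcongr
            rw [hη_def] at e1 e2 ⊢
            linarith
    have htail : ψ ε (N * δ) ≤ C₂ * R := by
      refine (hψb _ (by positivity)).trans ?_
      rw [hδN, hR]
      gcongr
      linarith [hκ.1]
    calc q ε ≤ _ := hup ε hε δ hδ0 N
      _ ≤ (∑ k ∈ Finset.range N, ∑ j ∈ Finset.range N, C₁ * (C₂ * C₂) * R) + 2 * (C₂ * R) := by
          exact add_le_add (Finset.sum_le_sum fun k _ => Finset.sum_le_sum fun j _ => hterm k j)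
            (mul_le_mul_of_nonneg_left htail (by norm_num))
      _ = D * R := by simp [hD]; ring
      _ ≤ Real.exp (κ / 3 * G ε) * R := by
          gcongr
          rw [div_le_iff₀ (by linarith [hκ.1])] at hGD
          rw [← Real.log_le_iff_le_exp hD0]
          linarith
      _ = Real.exp (-((1 - κ) * G ε)) := by
          rw [hR, ← Real.exp_add]; congr 1; ring

lemma biSup_Icc_abs_le_iff {f : ℝ → ℝ} (hf : Continuous f) {ε : ℝ} (hε : 0 ≤ ε) :
    ⨆ t ∈ Icc (0 : ℝ) 1, |f t| ≤ ε ↔ ∀ t ∈ Icc (0 : ℝ) 1, |f t| ≤ ε := by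
  refine ⟨fun h t ht => ?_, fun h => Real.iSup_le (fun t => Real.iSup_le (h t) hε) hε⟩
  obtain ⟨M, hM⟩ := isCompact_Icc.exists_bound_of_continuousOn (s := Icc (0 : ℝ) 1) hf.continuousOn
  have hM0 : 0 ≤ M := (norm_nonneg _).trans (hM 0 (by simp))
  have hbdd : BddAbove (range fun t => ⨆ (_ : t ∈ Icc (0 : ℝ) 1), |f t|) :=
    ⟨M, by rintro _ ⟨t, rfl⟩; exact Real.iSup_le (fun ht => hM t ht) hM0⟩
  have h1 := le_ciSup hbdd t
  rw [ciSup_pos ht] at h1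
  exact h1.trans h

lemma forall_Icc_abs_sub_le_iff {f : ℝ → ℝ} (hf : Continuous f) (y b : ℝ) :
    (∀ t ∈ Icc (0 : ℝ) 1, |f t - y| ≤ b) ↔
      ∀ n, |f (TopologicalSpace.denseSeq (Icc (0 : ℝ) 1) n) - y| ≤ b := by
  refine ⟨fun h n => h _ (Subtype.prop _), fun h t ht => ?_⟩
  have hcl : IsClosed {s : Icc (0 : ℝ) 1 | |f s - y| ≤ b} :=
    isClosed_le (by fun_prop) continuous_const
  have hsub := hcl.closure_subset_iff.2 (range_subset_iff.2 h)
  rw [(TopologicalSpace.denseRange_denseSeq _).closure_range] at hsub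
  exact hsub (mem_univ (⟨t, ht⟩ : Icc (0 : ℝ) 1))

/-- Comparison of small ball probabilities of continuous processes through their finite-dimensional
distributions. -/
lemma measure_forall_Icc_abs_sub_le_le {Ω' : Type*} [MeasurableSpace Ω'] {P : Measure Ω'}
    [IsFiniteMeasure P] {Y Z : ℝ → Ω' → ℝ}
    (hZ : ∀ ω, Continuous fun t => Z t ω) (hZm : ∀ t ∈ Icc (0 : ℝ) 1, AEMeasurable (Z t) P)
    {y b c : ℝ} (h : ∀ (n : ℕ) (t : Fin n → ℝ), (∀ i, t i ∈ Icc (0 : ℝ) 1) →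
      P {ω | ∀ i, |Y (t i) ω - y| ≤ b} ≤ P {ω | ∀ i, |Z (t i) ω| ≤ c}) :
    P {ω | ∀ t ∈ Icc (0 : ℝ) 1, |Y t ω - y| ≤ b} ≤ P {ω | ∀ t ∈ Icc (0 : ℝ) 1, |Z t ω| ≤ c} := by
  set u := TopologicalSpace.denseSeq (Icc (0 : ℝ) 1) with hu
  let S (n : ℕ) : Set Ω' := {ω | ∀ i : Fin n, |Z (u i) ω| ≤ c}
  have hS (n : ℕ) : NullMeasurableSet (S n) P := by
    have : S n = ⋂ i : Fin n, {ω | |Z (u i) ω| ≤ c} := by ext; simp [S]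
    rw [this]
    exact .iInter fun i => nullMeasurableSet_le
      ((hZm _ (u i).2).abs) aemeasurable_const
  have hanti : Antitone S := fun m n hmn ω hω i => hω (Fin.castLE hmn i)
  have hlim := tendsto_measure_iInter_atTop hS hanti ⟨0, measure_ne_top _ _⟩
  have hS' : {ω | ∀ t ∈ Icc (0 : ℝ) 1, |Z t ω| ≤ c} = ⋂ n, S n := by
    ext ω
    have := forall_Icc_abs_sub_le_iff (hZ ω) 0 c
    simp only [sub_zero] at this
    simp only [mem_ofPred_eq, this, mem_iInter, S]
    exact ⟨fun h n i => h i, fun h n => h (n + 1) (Fin.last n)⟩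
  rw [hS']
  refine ge_of_tendsto' hlim fun n => ?_
  refine le_trans (measure_mono ?_) (h n (fun i => u i) fun i => (u i).2)
  exact fun ω hω i => hω _ (u i).2

lemma IsFBM.aemeasurable [IsProbabilityMeasure (ℙ : Measure Ω)] {H : ℝ} {B : ℝ → Ω → ℝ}
    (hB : IsFBM H B) {t : ℝ} (ht : 0 ≤ t) : AEMeasurable (B t) ℙ := by
  have h := hB.2 1 (fun _ => t) (fun _ => ht) (fun _ => 1)
  simp only [Finset.univ_unique, Finset.sum_singleton, one_mul] at h
  refine AEMeasurable.of_map_ne_zero ?_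
  rw [h]
  exact IsProbabilityMeasure.ne_zero _

/-- Shifting the center does not increase the small ball probability of a fractional Brownian
motion. -/
lemma IsFBM.measure_abs_sub_le_le [IsProbabilityMeasure (ℙ : Measure Ω)] {H : ℝ} {B : ℝ → Ω → ℝ}
    (hB : IsFBM H B) (hc : ∀ ω, Continuous fun t => B t ω) (x b : ℝ) :
    ℙ {ω | ∀ t ∈ Icc (0 : ℝ) 1, |B t ω - x| ≤ b} ≤ ℙ {ω | ∀ t ∈ Icc (0 : ℝ) 1, |B t ω| ≤ b} :=
  measure_forall_Icc_abs_sub_le_le hc (fun _ ht => hB.aemeasurable ht.1) fun n t ht =>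
    measure_forall_abs_sub_le_le (fun a => ⟨_, hB.2 n t (fun i => (ht i).1) a⟩) x b

/-- Self-similarity of fractional Brownian motion, for small ball probabilities. -/
lemma IsFBM.measure_abs_mul_le [IsProbabilityMeasure (ℙ : Measure Ω)] {H : ℝ} {B W : ℝ → Ω → ℝ}
    (hB : IsFBM H B) (hW : IsFBM H W) (hBc : ∀ ω, Continuous fun t => B t ω)
    (hWc : ∀ ω, Continuous fun t => W t ω) {a : ℝ} (ha : 0 < a) (ε : ℝ) :
    ℙ {ω | ∀ t ∈ Icc (0 : ℝ) 1, |W (a * t) ω| ≤ ε} =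
      ℙ {ω | ∀ t ∈ Icc (0 : ℝ) 1, |B t ω| ≤ ε / a ^ H} := by
  have haH : 0 < a ^ H := Real.rpow_pos_of_pos ha H
  have hWm (t : ℝ) (ht : t ∈ Icc (0 : ℝ) 1) : AEMeasurable (W (a * t)) ℙ :=
    hW.aemeasurable (mul_nonneg ha.le ht.1)
  have hBm (t : ℝ) (ht : t ∈ Icc (0 : ℝ) 1) : AEMeasurable (fun ω => a ^ H * B t ω) ℙ :=
    (hB.aemeasurable ht.1).const_mul _
  have hfin (n : ℕ) (t : Fin n → ℝ) (ht : ∀ i, t i ∈ Icc (0 : ℝ) 1) :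
      ℙ {ω | ∀ i, |W (a * t i) ω| ≤ ε} = ℙ {ω | ∀ i, |a ^ H * B (t i) ω| ≤ ε} := by
    have hmap := map_pi_eq_of_forall_map_sum_eq (P := (ℙ : Measure Ω))
      (Y := fun i => W (a * t i)) (Z := fun i ω => a ^ H * B (t i) ω)
      (fun i => hWm _ (ht i)) (fun i => hBm _ (ht i)) fun w => by
        have h1 := hB.2 n t (fun i => (ht i).1) (fun i => w i * a ^ H)
        simp only [mul_assoc (w _)] at h1
        simp only [← mul_assoc (w _)] at h1 ⊢
        rw [hW.2 n (fun i => a * t i) (fun i => mul_nonneg ha.le (ht i).1) w, h1]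
        congr 2
        refine Finset.sum_congr rfl fun i _ => Finset.sum_congr rfl fun j _ => ?_
        rw [← mul_sub, abs_mul, abs_of_pos ha, Real.mul_rpow ha.le (ht i).1,
          Real.mul_rpow ha.le (ht j).1, Real.mul_rpow ha.le (abs_nonneg _),
          show a ^ (2 * H) = a ^ H * a ^ H by rw [← Real.rpow_add ha]; ring_nf]
        ring
    have hbox : MeasurableSet {y : Fin n → ℝ | ∀ i, |y i| ≤ ε} := by measurability
    have h1 := congr_arg (fun μ => μ {y : Fin n → ℝ | ∀ i, |y i| ≤ ε}) hmap
    beta_reduce at h1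
    rwa [Measure.map_apply_of_aemeasurable (aemeasurable_pi_lambda _ fun i => hWm _ (ht i)) hbox,
      Measure.map_apply_of_aemeasurable (aemeasurable_pi_lambda _ fun i => hBm _ (ht i)) hbox] at h1
  have hWc' (ω : Ω) : Continuous fun t => W (a * t) ω := (hWc ω).comp (continuous_const_mul a)
  have hBc' (ω : Ω) : Continuous fun t => a ^ H * B t ω := (hBc ω).const_mul _
  have hscale : {ω | ∀ t ∈ Icc (0 : ℝ) 1, |B t ω| ≤ ε / a ^ H} =
      {ω | ∀ t ∈ Icc (0 : ℝ) 1, |a ^ H * B t ω| ≤ ε} := by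
    ext ω
    simp only [mem_ofPred_eq, abs_mul, abs_of_pos haH, le_div_iff₀' haH]
  rw [hscale]
  refine le_antisymm ?_ ?_
  · have := measure_forall_Icc_abs_sub_le_le (Y := fun t => W (a * t)) (y := 0) (b := ε)
      (c := ε) hBc' hBm
      fun n t ht => by simpa only [sub_zero] using (hfin n t ht).le
    simpa only [sub_zero] using this
  · have := measure_forall_Icc_abs_sub_le_le (Y := fun t ω => a ^ H * B t ω) (y := 0) (b := ε)
      (c := ε) hWc' hWm
      fun n t ht => by simpa only [sub_zero] using (hfin n t ht).ge
    simpa only [sub_zero] using this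

lemma IsFBM.measure_abs_mul_le_eq [IsProbabilityMeasure (ℙ : Measure Ω)] {H : ℝ}
    {B W : ℝ → Ω → ℝ} (hB : IsFBM H B) (hW : IsFBM H W) (hBc : ∀ ω, Continuous fun t => B t ω)
    (hWc : ∀ ω, Continuous fun t => W t ω) {a : ℝ} (ha : 0 ≤ a) (ε : ℝ) :
    ℙ {ω | ∀ t ∈ Icc (0 : ℝ) 1, |W (a * t) ω| ≤ ε} =
      ℙ {ω | ∀ t ∈ Icc (0 : ℝ) 1, |B (a * t) ω| ≤ ε} := by
  rcases ha.eq_or_lt with rfl | ha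
  · simp [hB.1, hW.1]
  · rw [hB.measure_abs_mul_le hW hBc hWc ha, hB.measure_abs_mul_le hB hBc hBc ha]

lemma measure_inter_inter_eq_mul_of_indepFun {X₁ X₂ : ℝ → Ω → ℝ}
    (hcont₁ : ∀ ω, Continuous fun t => X₁ t ω) (hcont₂ : ∀ ω, Continuous fun t => X₂ t ω)
    (hIndep : IndepFun (fun ω => fun t : ℝ => X₁ t ω) (fun ω => fun t : ℝ => X₂ t ω) ℙ)
    (hIndep₂ : IndepFun (fun ω => fun t : {t : ℝ // 0 ≤ t} => X₂ t.1 ω)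
      (fun ω => fun t : {t : ℝ // 0 ≤ t} => X₂ (-t.1) ω) ℙ)
    {a a' : ℝ} (ha : 0 ≤ a) (ha' : 0 ≤ a') (x b ε : ℝ) :
    ℙ ({ω | ∀ t ∈ Icc (0 : ℝ) 1, |X₁ t ω - x| ≤ b} ∩
      ({ω | ∀ t ∈ Icc (0 : ℝ) 1, |X₂ (a * t) ω| ≤ ε} ∩
        {ω | ∀ t ∈ Icc (0 : ℝ) 1, |X₂ (-(a' * t)) ω| ≤ ε})) =
    ℙ {ω | ∀ t ∈ Icc (0 : ℝ) 1, |X₁ t ω - x| ≤ b} *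
      (ℙ {ω | ∀ t ∈ Icc (0 : ℝ) 1, |X₂ (a * t) ω| ≤ ε} *
        ℙ {ω | ∀ t ∈ Icc (0 : ℝ) 1, |X₂ (-(a' * t)) ω| ≤ ε}) := by
  set u := TopologicalSpace.denseSeq (Icc (0 : ℝ) 1) with hu
  have h1 (ω : Ω) := forall_Icc_abs_sub_le_iff (hcont₁ ω) x b
  have h2 (ω : Ω) := forall_Icc_abs_sub_le_iff (f := fun t => X₂ (a * t) ω)
    ((hcont₂ ω).comp (continuous_const_mul a)) 0 ε
  have h3 (ω : Ω) := forall_Icc_abs_sub_le_iff (f := fun t => X₂ (-(a' * t)) ω)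
    ((hcont₂ ω).comp (continuous_const_mul a').neg) 0 ε
  simp only [sub_zero, ← hu] at h1 h2 h3
  simp only [h1, h2, h3]
  have hu0 (n : ℕ) : (0 : ℝ) ≤ u n := (u n).2.1
  have key (v : ℕ → {t : ℝ // 0 ≤ t}) :
      MeasurableSet {f : {t : ℝ // 0 ≤ t} → ℝ | ∀ n, |f (v n)| ≤ ε} := by
    simp only [ofPred_forall]
    exact .iInter fun n => measurableSet_le (by fun_prop) measurable_const
  have hS : MeasurableSet {f : ℝ → ℝ | ∀ n, |f (u n) - x| ≤ b} := by
    simp only [ofPred_forall]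
    exact .iInter fun n => measurableSet_le (by fun_prop) measurable_const
  have hS₂ (v : ℕ → ℝ) : MeasurableSet {f : ℝ → ℝ | ∀ n, |f (v n)| ≤ ε} := by
    simp only [ofPred_forall]
    exact .iInter fun n => measurableSet_le (by fun_prop) measurable_const
  have e1 := hIndep.measure_inter_preimage_eq_mul _ _ hS
    ((hS₂ fun n => a * u n).inter (hS₂ fun n => -(a' * u n)))
  have e2 := hIndep₂.measure_inter_preimage_eq_mul _ _
    (key fun n => ⟨a * u n, mul_nonneg ha (hu0 n)⟩) (key fun n => ⟨a' * u n, mul_nonneg ha' (hu0 n)⟩)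
  exact e1.trans (congr_arg _ e2)

lemma forall_mul_Icc_iff {a : ℝ} (ha : 0 ≤ a) {p : ℝ → Prop} :
    (∀ t ∈ Icc (0 : ℝ) 1, p (a * t)) ↔ ∀ s ∈ Icc 0 a, p s := by
  refine ⟨fun h s hs => ?_, fun h t ht =>
    h _ ⟨mul_nonneg ha ht.1, mul_le_of_le_one_right ha ht.2⟩⟩
  rcases ha.eq_or_lt with rfl | ha
  · simpa [le_antisymm hs.2 hs.1] using h 0 (by simp)
  · simpa [mul_div_cancel₀ s ha.ne'] using
      h (s / a) ⟨div_nonneg hs.1 ha.le, (div_le_one ha).2 hs.2⟩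

lemma exists_range_of_forall_abs_comp_le {f g : ℝ → ℝ} (hf : Continuous f) (hf0 : f 0 = 0)
    {ε δ : ℝ} (hδ : 0 < δ) (N : ℕ) (h : ∀ t ∈ Icc (0 : ℝ) 1, |g (f t)| ≤ ε) :
    (∃ k ∈ Finset.range N, ∃ j ∈ Finset.range N,
      (∀ t ∈ Icc (0 : ℝ) 1, |f t - (k - j) * δ / 2| ≤ (k + j + 2) * δ / 2) ∧
      (∀ t ∈ Icc (0 : ℝ) 1, |g (k * δ * t)| ≤ ε) ∧
      ∀ t ∈ Icc (0 : ℝ) 1, |g (-(j * δ * t))| ≤ ε) ∨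
    (∀ t ∈ Icc (0 : ℝ) 1, |g (N * δ * t)| ≤ ε) ∨ ∀ t ∈ Icc (0 : ℝ) 1, |g (-(N * δ * t))| ≤ ε := by
  have hmem : (0 : ℝ) ∈ Icc (0 : ℝ) 1 := by simp
  obtain ⟨t₁, ht₁, hmax⟩ := isCompact_Icc.exists_isMaxOn ⟨_, hmem⟩ hf.continuousOn
  obtain ⟨t₀, ht₀, hmin⟩ := isCompact_Icc.exists_isMinOn ⟨_, hmem⟩ hf.continuousOn
  have h1 : 0 ≤ f t₁ := hf0 ▸ hmax hmem
  have h0 : f t₀ ≤ 0 := hf0 ▸ hmin hmem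
  have hrange (s : ℝ) (hs : s ∈ Icc (f t₀) (f t₁)) : |g s| ≤ ε := by
    obtain ⟨t, ht, rfl⟩ := isPreconnected_Icc.intermediate_value ht₀ ht₁ hf.continuousOn hs
    exact h t ht
  have hpos {k : ℕ} (hk : k ≤ f t₁ / δ) : ∀ t ∈ Icc (0 : ℝ) 1, |g (k * δ * t)| ≤ ε := by
    rw [le_div_iff₀ hδ] at hk
    exact (forall_mul_Icc_iff (p := fun s => |g s| ≤ ε) (by positivity)).2
      fun s hs => hrange s ⟨h0.trans hs.1, hs.2.trans hk⟩
  have hneg {j : ℕ} (hj : j ≤ -f t₀ / δ) : ∀ t ∈ Icc (0 : ℝ) 1, |g (-(j * δ * t))| ≤ ε := by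
    rw [le_div_iff₀ hδ] at hj
    exact (forall_mul_Icc_iff (p := fun s => |g (-s)| ≤ ε) (by positivity)).2
      fun s hs => hrange _ ⟨by linarith [hs.2], by linarith [hs.1]⟩
  have hk := Nat.floor_le (div_nonneg h1 hδ.le)
  have hj := Nat.floor_le (div_nonneg (neg_nonneg.2 h0) hδ.le)
  have hk' := Nat.lt_floor_add_one (f t₁ / δ)
  have hj' := Nat.lt_floor_add_one (-f t₀ / δ)
  by_cases hkN : ⌊f t₁ / δ⌋₊ < N
  · by_cases hjN : ⌊-f t₀ / δ⌋₊ < N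
    · refine .inl ⟨_, Finset.mem_range.2 hkN, _, Finset.mem_range.2 hjN, fun t ht => ?_,
        hpos hk, hneg hj⟩
      have e1 : f t ≤ f t₁ := hmax ht
      have e0 : f t₀ ≤ f t := hmin ht
      rw [div_lt_iff₀ hδ] at hk' hj'
      rw [abs_le]
      constructor <;> linarith
    · exact .inr (.inr (hneg ((Nat.cast_le.2 (not_lt.1 hjN)).trans hj)))
  · exact .inr (.inl (hpos ((Nat.cast_le.2 (not_lt.1 hkN)).trans hk)))

theorem statement8 [IsProbabilityMeasure (ℙ : Measure Ω)]
    (H₁ H₂ : ℝ) (hH₁ : H₁ ∈ Set.Ioo (0:ℝ) 1) (hH₂ : H₂ ∈ Set.Ioo (0:ℝ) 1)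
    (X₁ X₂ : ℝ → Ω → ℝ)
    (hfbm₁ : IsTwoSidedFBM H₁ X₁) (hfbm₂ : IsTwoSidedFBM H₂ X₂)
    (hcont₁ : ∀ ω, Continuous fun t => X₁ t ω)
    (hcont₂ : ∀ ω, Continuous fun t => X₂ t ω)
    (hIndep : IndepFun (fun ω => fun t : ℝ => X₁ t ω) (fun ω => fun t : ℝ => X₂ t ω) ℙ)
    (c₁ c₂ : ℝ) (hc₁ : 0 < c₁) (hc₂ : 0 < c₂)
    (hsd₁ : strongEquiv
      (fun ε => -Real.log ((ℙ {ω | ⨆ t ∈ Set.Icc (0:ℝ) 1, |X₁ t ω| ≤ ε}).toReal))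
      (fun ε => c₁ * ε ^ (-(1/H₁))))
    (hsd₂ : strongEquiv
      (fun ε => -Real.log ((ℙ {ω | ⨆ t ∈ Set.Icc (0:ℝ) 1, |X₂ t ω| ≤ ε}).toReal))
      (fun ε => c₂ * ε ^ (-(1/H₂)))) :
    strongEquiv
      (fun ε => -Real.log ((ℙ {ω | ⨆ t ∈ Set.Icc (0:ℝ) 1, |X₂ (X₁ t ω) ω| ≤ ε}).toReal))
      (fun ε => (1 + 1/H₁) * (c₁ ^ H₁ * (2 * H₁ * c₂)) ^ (1/(1+H₁)) *
        ε ^ (-(1 / (H₂ * (1 + H₁))))) := by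
  have hcont (ω : Ω) : Continuous fun t => X₂ (X₁ t ω) ω := (hcont₂ ω).comp (hcont₁ ω)
  have hneg (ω : Ω) : Continuous fun t => X₂ (-t) ω := (hcont₂ ω).comp continuous_neg
  have hset {W : ℝ → Ω → ℝ} (hW : ∀ ω, Continuous fun t => W t ω) {g : ℝ → ℝ} :
      strongEquiv
        (fun ε => -Real.log (ℙ {ω | ⨆ t ∈ Set.Icc (0 : ℝ) 1, |W t ω| ≤ ε}).toReal) g ↔
      strongEquiv
        (fun ε => -Real.log (ℙ {ω | ∀ t ∈ Set.Icc (0 : ℝ) 1, |W t ω| ≤ ε}).toReal) g := by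
    refine Filter.tendsto_congr' ?_
    filter_upwards [self_mem_nhdsWithin] with ε hε
    simp only [biSup_Icc_abs_le_iff (hW _) (mem_Ioi.1 hε).le]
  rw [hset hcont₁] at hsd₁
  rw [hset hcont₂] at hsd₂
  rw [hset hcont]
  let ψ (ε a : ℝ) : ℝ := (ℙ {ω | ∀ t ∈ Set.Icc (0 : ℝ) 1, |X₂ (a * t) ω| ≤ ε}).toReal
  have hψneg (ε a : ℝ) (ha : 0 ≤ a) :
      (ℙ {ω | ∀ t ∈ Set.Icc (0 : ℝ) 1, |X₂ (-(a * t)) ω| ≤ ε}).toReal = ψ ε a :=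
    congr_arg ENNReal.toReal (hfbm₂.2.1.measure_abs_mul_le_eq hfbm₂.2.2 hcont₂ hneg ha ε)
  have hprod (a a' x b ε : ℝ) (ha : 0 ≤ a) (ha' : 0 ≤ a') :
      (ℙ ({ω | ∀ t ∈ Icc (0 : ℝ) 1, |X₁ t ω - x| ≤ b} ∩
        ({ω | ∀ t ∈ Icc (0 : ℝ) 1, |X₂ (a * t) ω| ≤ ε} ∩
          {ω | ∀ t ∈ Icc (0 : ℝ) 1, |X₂ (-(a' * t)) ω| ≤ ε}))).toReal =
      (ℙ {ω | ∀ t ∈ Icc (0 : ℝ) 1, |X₁ t ω - x| ≤ b}).toReal * (ψ ε a * ψ ε a') := by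
    rw [measure_inter_inter_eq_mul_of_indepFun hcont₁ hcont₂ hIndep hfbm₂.1 ha ha',
      ENNReal.toReal_mul, ENNReal.toReal_mul, hψneg ε a' ha']
  refine strongEquiv_of_iterated_bounds hH₁.1 hH₂.1 hc₁ hc₂ (ψ := ψ)
    (fun _ => ENNReal.toReal_nonneg) (fun _ => measureReal_le_one)
    (fun _ => ENNReal.toReal_nonneg) (fun _ => measureReal_le_one)
    (fun _ _ => ENNReal.toReal_nonneg) (fun _ _ => measureReal_le_one)
    (fun ε _ a ha => congr_arg ENNReal.toReal
      (hfbm₂.2.1.measure_abs_mul_le hfbm₂.2.1 hcont₂ hcont₂ ha ε))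
    hsd₁ hsd₂ (fun ε _ ρ hρ => ?_) (fun ε _ δ hδ N => ?_)
  · have h1 := hprod ρ ρ 0 ρ ε hρ.le hρ.le
    simp only [sub_zero] at h1
    rw [← h1]
    refine measureReal_mono ?_
    rintro ω ⟨h₁, h₂, h₃⟩ t ht
    have h₂' := (forall_mul_Icc_iff (p := fun s => |X₂ s ω| ≤ ε) hρ.le).1 h₂
    have h₃' := (forall_mul_Icc_iff (p := fun s => |X₂ (-s) ω| ≤ ε) hρ.le).1 h₃
    obtain ⟨h4, h5⟩ := abs_le.1 (h₁ t ht)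
    rcases le_total 0 (X₁ t ω) with h0 | h0
    · exact h₂' _ ⟨h0, h5⟩
    · simpa using h₃' (-X₁ t ω) ⟨by linarith, by linarith⟩
  · let E (k j : ℕ) : Set Ω :=
      {ω | ∀ t ∈ Icc (0 : ℝ) 1, |X₁ t ω - (k - j) * δ / 2| ≤ (k + j + 2) * δ / 2} ∩
        ({ω | ∀ t ∈ Icc (0 : ℝ) 1, |X₂ (k * δ * t) ω| ≤ ε} ∩
          {ω | ∀ t ∈ Icc (0 : ℝ) 1, |X₂ (-(j * δ * t)) ω| ≤ ε})
    have hE (k j : ℕ) : (ℙ : Measure Ω).real (E k j) ≤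
        (ℙ {ω | ∀ t ∈ Icc (0 : ℝ) 1, |X₁ t ω| ≤ (k + j + 2) * δ / 2}).toReal *
          (ψ ε (k * δ) * ψ ε (j * δ)) := by
      refine (hprod _ _ _ _ _ (by positivity) (by positivity)).trans_le ?_
      refine mul_le_mul_of_nonneg_right (ENNReal.toReal_mono (measure_ne_top _ _) ?_)
        (mul_nonneg ENNReal.toReal_nonneg ENNReal.toReal_nonneg)
      exact hfbm₁.2.1.measure_abs_sub_le_le hcont₁ _ _
    have hsub : {ω | ∀ t ∈ Icc (0 : ℝ) 1, |X₂ (X₁ t ω) ω| ≤ ε} ⊆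
        (⋃ k ∈ Finset.range N, ⋃ j ∈ Finset.range N, E k j) ∪
          ({ω | ∀ t ∈ Icc (0 : ℝ) 1, |X₂ (N * δ * t) ω| ≤ ε} ∪
            {ω | ∀ t ∈ Icc (0 : ℝ) 1, |X₂ (-(N * δ * t)) ω| ≤ ε}) := by
      intro ω hω
      rcases exists_range_of_forall_abs_comp_le (g := fun s => X₂ s ω) (hcont₁ ω)
        (hfbm₁.2.1.1 ω) hδ N hω with ⟨k, hk, j, hj, h⟩ | h | h
      · exact .inl (mem_iUnion₂.2 ⟨k, hk, mem_iUnion₂.2 ⟨j, hj, h⟩⟩)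
      · exact .inr (.inl h)
      · exact .inr (.inr h)
    refine (measureReal_mono hsub).trans ((measureReal_union_le _ _).trans (add_le_add ?_ ?_))
    · refine (measureReal_biUnion_finset_le _ _).trans (Finset.sum_le_sum fun k _ => ?_)
      exact (measureReal_biUnion_finset_le _ _).trans (Finset.sum_le_sum fun j _ => hE k j)
    · refine (measureReal_union_le _ _).trans ?_
      rw [two_mul]
      exact add_le_add le_rfl (hψneg ε (N * δ) (by positivity)).le
end
end
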